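/- arXiv:0709.2830 — 3 statements merged into one kernel-verified Lean document; each statement's English description precedes it below -/
import Mathlib

section
/- Assume u₋ is strictly concave at 0. Let ρ̲ ≤ c ≤ ρ̄ and x₊ ≥ x₀⁺ be given. (i) If c = ρ̄ and x₊ = x₀, then X* = 0 is optimal for the negative part problem with parameters ({ρ ≤ c}, x₊) and v₋(c, x₊) = 0. (ii) If c = ρ̄ and x₊ ≠ x₀, then the negative part problem has no feasible solution and v₋(c, x₊) = +∞. (iii) If ρ̲ ≤ c < ρ̄, then v₋(c, x₊) = inf_{c̄ ∈ [c, ρ̄)} u₋((x₊ − x₀)/E[ρ·1_{ρ>c̄}])·T₋(1 − F(c̄)); moreover the negative part problem with parameters ({ρ ≤ c}, x₊) admits an optimal solution X* if and only if this infimum over c̄ ∈ [c, ρ̄) is attained at some c̄*, in which case X* = ((x₊ − x₀)/E[ρ·1_{ρ>c̄*}])·1_{ρ>c̄*} a.s. -/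
open MeasureTheory Set Filter
open scoped ENNReal symmDiff

noncomputable section

/-- The data of the continuous-time behavioral portfolio selection model:
a probability space, the pricing kernel `ρ`, the utilities `up = u₊`, `um = u₋`
(with the derivatives `up'`, `up''` of `u₊`), the probability distortions
`Tp = T₊`, `Tm = T₋`, and the initial endowment `x0`. -/
structure BSetup (Ω : Type*) [MeasurableSpace Ω] where
  P : MeasureTheory.Measure Ω
  isProb : MeasureTheory.IsProbabilityMeasure P
  ρ : Ω → ℝ
  meas_ρ : Measurable ρ
  ρ_pos : ∀ᵐ ω ∂P, 0 < ρ ω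
  ρ_int : MeasureTheory.Integrable ρ P
  Eρ_pos : 0 < ∫ ω, ρ ω ∂P
  ρ_atomless : ∀ a : ℝ, P {ω | ρ ω = a} = 0
  up : ℝ → ℝ
  um : ℝ → ℝ
  up' : ℝ → ℝ
  up'' : ℝ → ℝ
  up_mono : StrictMonoOn up (Set.Ici 0)
  um_mono : StrictMonoOn um (Set.Ici 0)
  up_concave : ConcaveOn ℝ (Set.Ici 0) up
  um_concave : ConcaveOn ℝ (Set.Ici 0) um
  up_zero : up 0 = 0
  um_zero : um 0 = 0
  up_sconcave : StrictConcaveOn ℝ (Set.Ici 0) up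
  up_deriv : ∀ x ∈ Set.Ioi (0:ℝ), HasDerivAt up (up' x) x
  up_deriv2 : ∀ x ∈ Set.Ioi (0:ℝ), HasDerivAt up' (up'' x) x
  up'_zero : Filter.Tendsto up' (nhdsWithin 0 (Set.Ioi 0)) Filter.atTop
  up'_atTop : Filter.Tendsto up' Filter.atTop (nhds 0)
  Tp : ℝ → ℝ
  Tm : ℝ → ℝ
  Tp_mono : StrictMonoOn Tp (Set.Icc 0 1)
  Tm_mono : StrictMonoOn Tm (Set.Icc 0 1)
  Tp_diff : DifferentiableOn ℝ Tp (Set.Icc 0 1)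
  Tm_diff : DifferentiableOn ℝ Tm (Set.Icc 0 1)
  Tp_zero : Tp 0 = 0
  Tm_zero : Tm 0 = 0
  Tp_one : Tp 1 = 1
  Tm_one : Tm 1 = 1
  x0 : ℝ

variable {Ω : Type*} [MeasurableSpace Ω]

/-- `V₊(Y) = ∫₀^∞ T₊(P{u₊(Y) > y}) dy`, as a value in `[0,∞]`. -/
def Vpl (S : BSetup Ω) (Y : Ω → ℝ) : ℝ≥0∞ :=
  ∫⁻ y in Set.Ioi (0:ℝ), ENNReal.ofReal (S.Tp ((S.P {ω | y < S.up (Y ω)}).toReal))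

/-- `V₋(Y) = ∫₀^∞ T₋(P{u₋(Y) > y}) dy`, as a value in `[0,∞]`. -/
def Vmn (S : BSetup Ω) (Y : Ω → ℝ) : ℝ≥0∞ :=
  ∫⁻ y in Set.Ioi (0:ℝ), ENNReal.ofReal (S.Tm ((S.P {ω | y < S.um (Y ω)}).toReal))

/-- `V(X) = V₊(X⁺) − V₋(X⁻)`, an extended real number. -/
def Vval (S : BSetup Ω) (X : Ω → ℝ) : EReal :=
  (Vpl S (fun ω => max (X ω) 0)).toEReal - (Vmn S (fun ω => max (-X ω) 0)).toEReal

/-- Feasibility for Problem (P): `X` is a random variable, a.s. bounded below,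
with `E[ρX] = x₀`. -/
def FeasP (S : BSetup Ω) (X : Ω → ℝ) : Prop :=
  AEMeasurable X S.P ∧ (∃ b : ℝ, ∀ᵐ ω ∂S.P, b ≤ X ω) ∧
    MeasureTheory.Integrable (fun ω => S.ρ ω * X ω) S.P ∧
    (∫ ω, S.ρ ω * X ω ∂S.P) = S.x0

/-- The supremum value of Problem (P). -/
def supP (S : BSetup Ω) : EReal :=
  sSup {v : EReal | ∃ X : Ω → ℝ, FeasP S X ∧ v = Vval S X}

/-- Problem (P) is ill-posed if its supremum value is `+∞`. -/
def IllposedP (S : BSetup Ω) : Prop := supP S = ⊤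

/-- `X` is an optimal solution of Problem (P). -/
def OptimalP (S : BSetup Ω) (X : Ω → ℝ) : Prop :=
  FeasP S X ∧ ∀ Y : Ω → ℝ, FeasP S Y → Vval S Y ≤ Vval S X

/-- Feasibility for the positive part problem with parameters `(A, x₊)`. -/
def FeasPos (S : BSetup Ω) (A : Set Ω) (xp : ℝ) (X : Ω → ℝ) : Prop :=
  AEMeasurable X S.P ∧ (∀ᵐ ω ∂S.P, 0 ≤ X ω) ∧
    MeasureTheory.Integrable (fun ω => S.ρ ω * X ω) S.P ∧
    (∫ ω, S.ρ ω * X ω ∂S.P) = xp ∧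
    (∀ᵐ ω ∂S.P, ω ∉ A → X ω = 0)

/-- Optimality for the positive part problem with parameters `(A, x₊)`. -/
def OptPos (S : BSetup Ω) (A : Set Ω) (xp : ℝ) (X : Ω → ℝ) : Prop :=
  FeasPos S A xp X ∧ ∀ Y : Ω → ℝ, FeasPos S A xp Y → Vpl S Y ≤ Vpl S X

/-- The value `v₊(A, x₊)` of the positive part problem. -/
def vPos (S : BSetup Ω) (A : Set Ω) (xp : ℝ) : EReal :=
  if S.P A = 0 then (if xp = 0 then 0 else ⊥)
  else sSup {v : EReal | ∃ X : Ω → ℝ, FeasPos S A xp X ∧ v = (Vpl S X).toEReal}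

/-- Feasibility for the negative part problem with parameters `(A, x₊)`. -/
def FeasNeg (S : BSetup Ω) (A : Set Ω) (xp : ℝ) (X : Ω → ℝ) : Prop :=
  AEMeasurable X S.P ∧ (∀ᵐ ω ∂S.P, 0 ≤ X ω) ∧ (∃ b : ℝ, ∀ᵐ ω ∂S.P, X ω ≤ b) ∧
    MeasureTheory.Integrable (fun ω => S.ρ ω * X ω) S.P ∧
    (∫ ω, S.ρ ω * X ω ∂S.P) = xp - S.x0 ∧
    (∀ᵐ ω ∂S.P, ω ∈ A → X ω = 0)

/-- Optimality for the negative part problem with parameters `(A, x₊)`. -/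
def OptNeg (S : BSetup Ω) (A : Set Ω) (xp : ℝ) (X : Ω → ℝ) : Prop :=
  FeasNeg S A xp X ∧ ∀ Y : Ω → ℝ, FeasNeg S A xp Y → Vmn S X ≤ Vmn S Y

/-- The value `v₋(A, x₊)` of the negative part problem. -/
def vNeg (S : BSetup Ω) (A : Set Ω) (xp : ℝ) : EReal :=
  if S.P A = 1 then (if xp = S.x0 then 0 else ⊤)
  else sInf {v : EReal | ∃ X : Ω → ℝ, FeasNeg S A xp X ∧ v = (Vmn S X).toEReal}

/-- Feasibility for Problem (S). -/
def FeasS (S : BSetup Ω) (A : Set Ω) (xp : ℝ) : Prop :=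
  MeasurableSet A ∧ max S.x0 0 ≤ xp ∧ (S.P A = 0 → xp = 0) ∧ (S.P A = 1 → xp = S.x0)

/-- The objective of Problem (S): `v₊(A, x₊) − v₋(A, x₊)`. -/
def objS (S : BSetup Ω) (A : Set Ω) (xp : ℝ) : EReal := vPos S A xp - vNeg S A xp

/-- The supremum value of Problem (S). -/
def supS (S : BSetup Ω) : EReal :=
  sSup {v : EReal | ∃ (A : Set Ω) (xp : ℝ), FeasS S A xp ∧ v = objS S A xp}

/-- Optimality for Problem (S). -/
def OptS (S : BSetup Ω) (A : Set Ω) (xp : ℝ) : Prop :=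
  FeasS S A xp ∧ ∀ (B : Set Ω) (yp : ℝ), FeasS S B yp → objS S B yp ≤ objS S A xp

/-- `ρ̄ = esssup ρ` (an extended real number). -/
def rhoBar (S : BSetup Ω) : EReal := essSup (fun ω => (S.ρ ω : EReal)) S.P

/-- `ρ̲ = essinf ρ` (an extended real number). -/
def rhoLow (S : BSetup Ω) : EReal := essInf (fun ω => (S.ρ ω : EReal)) S.P

/-- The event `{ρ ≤ c}`. -/
def lev (S : BSetup Ω) (c : EReal) : Set Ω := {ω | (S.ρ ω : EReal) ≤ c}

/-- Feasibility of `(c, x₊)` for Problems (S_c) and (M). -/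
def FeasSc (S : BSetup Ω) (c : EReal) (xp : ℝ) : Prop :=
  rhoLow S ≤ c ∧ c ≤ rhoBar S ∧ max S.x0 0 ≤ xp ∧
    (c = rhoLow S → xp = 0) ∧ (c = rhoBar S → xp = S.x0)

/-- The objective of Problem (S_c): `v₊(c, x₊) − v₋(c, x₊)`. -/
def objSc (S : BSetup Ω) (c : EReal) (xp : ℝ) : EReal :=
  vPos S (lev S c) xp - vNeg S (lev S c) xp

/-- Optimality for Problem (S_c). -/
def OptSc (S : BSetup Ω) (c : EReal) (xp : ℝ) : Prop :=
  FeasSc S c xp ∧ ∀ (c' : EReal) (xp' : ℝ), FeasSc S c' xp' → objSc S c' xp' ≤ objSc S c xp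

/-- The supremum value of Problem (S_c). -/
def supSc (S : BSetup Ω) : EReal :=
  sSup {v : EReal | ∃ (c : EReal) (xp : ℝ), FeasSc S c xp ∧ v = objSc S c xp}

/-- The distribution function `F` of `ρ`. -/
def Fdist (S : BSetup Ω) (x : ℝ) : ℝ := (S.P {ω | S.ρ ω ≤ x}).toReal

/-- The distribution function of `ρ` evaluated at an extended real `c`. -/
def FdistE (S : BSetup Ω) (c : EReal) : ℝ := (S.P {ω | (S.ρ ω : EReal) ≤ c}).toReal

/-- `E[ρ·1_{ρ>c}]`. -/
def ERhoGt (S : BSetup Ω) (c : EReal) : ℝ :=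
  ∫ ω, (if c < (S.ρ ω : EReal) then S.ρ ω else 0) ∂S.P

/-- The objective of Problem (M):
`v₊(c, x₊) − u₋((x₊−x₀)/E[ρ1_{ρ>c}])·T₋(1−F(c))`.  (When `c = ρ̄` and `x₊ = x₀`
the subtracted term vanishes, realizing the convention of the paper.) -/
def objM (S : BSetup Ω) (c : EReal) (xp : ℝ) : EReal :=
  vPos S (lev S c) xp -
    ((S.um ((xp - S.x0) / ERhoGt S c) * S.Tm (1 - FdistE S c) : ℝ) : EReal)

/-- Optimality for Problem (M). -/
def OptM (S : BSetup Ω) (c : EReal) (xp : ℝ) : Prop :=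
  FeasSc S c xp ∧ ∀ (c' : EReal) (xp' : ℝ), FeasSc S c' xp' → objM S c' xp' ≤ objM S c xp

/-- The supremum value of Problem (M). -/
def supM (S : BSetup Ω) : EReal :=
  sSup {v : EReal | ∃ (c : EReal) (xp : ℝ), FeasSc S c xp ∧ v = objM S c xp}

/-- The generalized inverse `F⁻¹(z) = inf{y ≥ 0 : F(y) ≥ z}` of the distribution
function of `ρ`, valued in the extended reals (`= +∞` if no such `y` exists). -/
def FinvE (S : BSetup Ω) (z : ℝ) : EReal :=
  sInf {c : EReal | ∃ y : ℝ, 0 ≤ y ∧ z ≤ Fdist S y ∧ c = (y : EReal)}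

/-- The finiteness condition: `V₊(X) < ∞` whenever `X ≥ 0` a.s. and `E[ρX] < ∞`. -/
def FinCond (S : BSetup Ω) : Prop :=
  ∀ X : Ω → ℝ, AEMeasurable X S.P → (∀ᵐ ω ∂S.P, 0 ≤ X ω) →
    MeasureTheory.Integrable (fun ω => S.ρ ω * X ω) S.P → Vpl S X < ⊤

/-- `u` is strictly concave at `0`: `u(λx) > λu(x)` for `x > 0`, `λ ∈ (0,1)`. -/
def StrictConcaveAtZero (u : ℝ → ℝ) : Prop :=
  ∀ x : ℝ, 0 < x → ∀ l : ℝ, 0 < l → l < 1 → l * u x < u (l * x)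


/-- A concave increasing function on `[0, ∞)` lies below a line of nonnegative slope through each
point of its graph over `(0, ∞)`. -/
lemma exists_supporting_line {u : ℝ → ℝ} (hu : ConcaveOn ℝ (Ici 0) u)
    (hm : StrictMonoOn u (Ici 0)) {x : ℝ} (hx : 0 < x) :
    ∃ k : ℝ, 0 ≤ k ∧ ∀ y, 0 ≤ y → u y ≤ u x + k * (y - x) := by
  have hv : ConvexOn ℝ (Ici 0) (-u) := hu.neg
  have hxi : x ∈ interior (Ici (0 : ℝ)) := by simpa using hx
  set d := derivWithin (-u) (Ioi x) x with hd
  have key : ∀ y, 0 ≤ y → u y ≤ u x + (-d) * (y - x) := by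
    intro y hy
    rcases lt_trichotomy y x with h | rfl | h
    · have h1 := hv.slope_le_leftDeriv_of_mem_interior (show y ∈ Ici (0 : ℝ) from hy) hxi h
      have h2 := hv.leftDeriv_le_rightDeriv_of_mem_interior hxi
      have h3 := h1.trans h2
      rw [slope_def_field, div_le_iff₀ (sub_pos.2 h)] at h3
      simp only [Pi.neg_apply] at h3
      linarith
    · simp
    · have h1 := hv.rightDeriv_le_slope_of_mem_interior hxi (show y ∈ Ici (0 : ℝ) from hy) h
      rw [slope_def_field, le_div_iff₀ (sub_pos.2 h)] at h1
      simp only [Pi.neg_apply] at h1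
      linarith
  refine ⟨-d, ?_, key⟩
  have h1 := key (x + 1) (by linarith)
  have h2 := hm (show x ∈ Ici (0 : ℝ) from hx.le) (show x + 1 ∈ Ici (0 : ℝ) by simp; linarith)
    (by linarith)
  linarith

/-- Jensen's inequality for the weight `w` on `D`, with an integrand that needs no continuity
of `u` at the origin. -/
lemma setLIntegral_perspective_le {u : ℝ → ℝ} (hu : ConcaveOn ℝ (Ici 0) u)
    (hm : StrictMonoOn u (Ici 0)) (h0 : u 0 = 0) {D : Set ℝ} (hD : MeasurableSet D)
    {w : ℝ → ℝ} (hw : Measurable w) (hwpos : ∀ t ∈ D, 0 < w t) {s l : ℝ} (hs : 0 < s)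
    (hl : 0 < l) (hvol : volume D = ENNReal.ofReal s)
    (hint : ∫⁻ t in D, ENNReal.ofReal (w t) = ENNReal.ofReal l) :
    ∫⁻ t in D, ENNReal.ofReal (u (1 / w t) * w t) ≤ ENNReal.ofReal (l * u (s / l)) := by
  obtain ⟨k, hk, hline⟩ := exists_supporting_line hu hm (div_pos hs hl)
  set x := s / l with hx
  have hb : 0 ≤ u x - k * x := by
    have := hline 0 le_rfl
    rw [h0] at this
    linarith
  calc ∫⁻ t in D, ENNReal.ofReal (u (1 / w t) * w t)
      ≤ ∫⁻ t in D, (ENNReal.ofReal (u x - k * x) * ENNReal.ofReal (w t) + ENNReal.ofReal k) := by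
        refine setLIntegral_mono' hD fun t ht => ?_
        have hp := hwpos t ht
        rw [← ENNReal.ofReal_mul hb, ← ENNReal.ofReal_add (mul_nonneg hb hp.le) hk]
        refine ENNReal.ofReal_le_ofReal ?_
        have h1 := mul_le_mul_of_nonneg_right (hline (1 / w t) (by positivity)) hp.le
        have h2 : (u x + k * (1 / w t - x)) * w t = (u x - k * x) * w t + k := by
          field_simp
          ring
        linarith
    _ = ENNReal.ofReal (l * u x) := by
        rw [lintegral_add_right _ measurable_const, lintegral_const_mul _ hw.ennreal_ofReal, hint,
          setLIntegral_const, hvol, ← ENNReal.ofReal_mul hb, ← ENNReal.ofReal_mul hk,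
          ← ENNReal.ofReal_add (mul_nonneg hb hl.le) (mul_nonneg hk hs.le)]
        congr 1
        rw [hx]
        field_simp
        ring

lemma StrictMonoOn.nonneg_of_zero {u : ℝ → ℝ} (hm : StrictMonoOn u (Ici 0)) (h0 : u 0 = 0)
    {x : ℝ} (hx : 0 ≤ x) : 0 ≤ u x := by
  rw [← h0]
  exact hm.monotoneOn self_mem_Ici hx hx

lemma StrictMonoOn.pos_of_zero {u : ℝ → ℝ} (hm : StrictMonoOn u (Ici 0)) (h0 : u 0 = 0)
    {x : ℝ} (hx : 0 < x) : 0 < u x := by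
  rw [← h0]
  exact hm self_mem_Ici hx.le hx

/-- A concave increasing function on `[0, ∞)` is left-continuous on `(0, ∞)`. -/
lemma exists_lt_of_lt_concave {u : ℝ → ℝ} (hu : ConcaveOn ℝ (Ici 0) u) {s y : ℝ} (hs : 0 < s)
    (hy : y < u s) : ∃ r, 0 < r ∧ r < s ∧ y < u r := by
  have hc : ContinuousAt u s := by
    have := hu.continuousOn_interior
    rw [interior_Ici] at this
    exact this.continuousAt (Ioi_mem_nhds hs)
  have h1 : ∀ᶠ r in nhds s, y < u r ∧ 0 < r :=
    (hc.eventually (lt_mem_nhds hy)).and (lt_mem_nhds hs)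
  have h2 : ∀ᶠ r in nhdsWithin s (Iio s), (y < u r ∧ 0 < r) ∧ r < s :=
    (h1.filter_mono nhdsWithin_le_nhds).and self_mem_nhdsWithin
  obtain ⟨r, hr⟩ := h2.exists
  exact ⟨r, hr.1.2, hr.2, hr.1.1⟩

instance (S : BSetup Ω) : IsProbabilityMeasure S.P := S.isProb

lemma BSetup.toReal_mem_Icc (S : BSetup Ω) (A : Set Ω) : (S.P A).toReal ∈ Icc (0 : ℝ) 1 :=
  ⟨ENNReal.toReal_nonneg, measureReal_le_one⟩

lemma BSetup.Tm_mono_measure (S : BSetup Ω) {A B : Set Ω} (h : S.P A ≤ S.P B) :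
    S.Tm (S.P A).toReal ≤ S.Tm (S.P B).toReal :=
  S.Tm_mono.monotoneOn (S.toReal_mem_Icc A) (S.toReal_mem_Icc B)
    (ENNReal.toReal_mono (measure_ne_top _ _) h)

lemma BSetup.Tm_nonneg_measure (S : BSetup Ω) (A : Set Ω) : 0 ≤ S.Tm (S.P A).toReal := by
  have := S.Tm_mono_measure (measure_mono (empty_subset A))
  simpa [S.Tm_zero] using this

lemma BSetup.Tm_lt_measure (S : BSetup Ω) {A B : Set Ω} (h : S.P A < S.P B) :
    S.Tm (S.P A).toReal < S.Tm (S.P B).toReal :=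
  S.Tm_mono (S.toReal_mem_Icc A) (S.toReal_mem_Icc B)
    ((ENNReal.toReal_lt_toReal (measure_ne_top _ _) (measure_ne_top _ _)).2 h)

lemma Vmn_congr (S : BSetup Ω) {X Y : Ω → ℝ} (h : X =ᵐ[S.P] Y) : Vmn S X = Vmn S Y := by
  unfold Vmn
  refine lintegral_congr fun y => ?_
  rw [measure_congr (eventuallyEq_set.2 (h.mono fun ω hω => ?_))]
  simp [hω]

lemma Vmn_indicator (S : BSetup Ω) (B : Set Ω) {k : ℝ} (hk : 0 ≤ k) :
    Vmn S (B.indicator fun _ => k) = ENNReal.ofReal (S.um k * S.Tm (S.P B).toReal) := by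
  have huk := S.um_mono.nonneg_of_zero S.um_zero hk
  have h1 : ∀ y ∈ Ioi (0 : ℝ),
      ENNReal.ofReal (S.Tm (S.P {ω | y < S.um (B.indicator (fun _ => k) ω)}).toReal) =
        (Iio (S.um k)).indicator (fun _ => ENNReal.ofReal (S.Tm (S.P B).toReal)) y := by
    intro y hy
    by_cases hyk : y < S.um k
    · have : {ω | y < S.um (B.indicator (fun _ => k) ω)} = B := by
        ext ω
        by_cases hω : ω ∈ B
        · simp [hω, hyk]
        · simp [hω, S.um_zero, (mem_Ioi.1 hy).le]
      simp [this, hyk]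
    · have : {ω | y < S.um (B.indicator (fun _ => k) ω)} = ∅ := by
        ext ω
        by_cases hω : ω ∈ B
        · simpa [hω] using hyk
        · simp [hω, S.um_zero, (mem_Ioi.1 hy).le]
      simp [this, hyk, S.Tm_zero]
  rw [Vmn, setLIntegral_congr_fun measurableSet_Ioi h1, lintegral_indicator measurableSet_Iio,
    setLIntegral_const, Measure.restrict_apply measurableSet_Iio, inter_comm, Ioi_inter_Iio,
    Real.volume_Ioo, sub_zero, mul_comm, ENNReal.ofReal_mul huk]

/-- The measure with density `ρ` with respect to `P`. -/
def BSetup.cost (S : BSetup Ω) : Measure Ω := S.P.withDensity fun ω => ENNReal.ofReal (S.ρ ω)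

lemma BSetup.cost_apply (S : BSetup Ω) {B : Set Ω} (hB : MeasurableSet B) :
    S.cost B = ENNReal.ofReal (∫ ω in B, S.ρ ω ∂S.P) := by
  rw [BSetup.cost, withDensity_apply _ hB,
    ofReal_integral_eq_lintegral_ofReal S.ρ_int.integrableOn]
  exact ae_restrict_of_ae (S.ρ_pos.mono fun _ h => h.le)

instance (S : BSetup Ω) : IsFiniteMeasure S.cost :=
  ⟨by rw [S.cost_apply MeasurableSet.univ]; exact ENNReal.ofReal_lt_top⟩

lemma BSetup.cost_ac (S : BSetup Ω) : S.cost ≪ S.P := withDensity_absolutelyContinuous _ _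

lemma BSetup.ac_cost (S : BSetup Ω) : S.P ≪ S.cost := by
  refine withDensity_absolutelyContinuous' S.meas_ρ.ennreal_ofReal.aemeasurable ?_
  filter_upwards [S.ρ_pos] with ω h
  simpa using h

lemma BSetup.setIntegral_nonneg (S : BSetup Ω) (B : Set Ω) : 0 ≤ ∫ ω in B, S.ρ ω ∂S.P :=
  integral_nonneg_of_ae (ae_restrict_of_ae (S.ρ_pos.mono fun _ h => h.le))

lemma ERhoGt_coe (S : BSetup Ω) (x : ℝ) :
    ERhoGt S x = ∫ ω in {ω | x < S.ρ ω}, S.ρ ω ∂S.P := by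
  rw [← integral_indicator (measurableSet_lt measurable_const S.meas_ρ), ERhoGt]
  refine integral_congr_ae (ae_of_all _ fun ω => ?_)
  simp [indicator_apply]

lemma ERhoGt_coe_eq_cost (S : BSetup Ω) (x : ℝ) :
    ERhoGt S x = (S.cost {ω | x < S.ρ ω}).toReal := by
  rw [S.cost_apply (measurableSet_lt measurable_const S.meas_ρ), ERhoGt_coe,
    ENNReal.toReal_ofReal (S.setIntegral_nonneg _)]

lemma one_sub_FdistE_coe (S : BSetup Ω) (x : ℝ) :
    1 - FdistE S x = (S.P {ω | x < S.ρ ω}).toReal := by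
  have h := prob_compl_eq_one_sub (μ := S.P) (measurableSet_le S.meas_ρ (measurable_const (a := x)))
  have h2 : {ω | S.ρ ω ≤ x}ᶜ = {ω | x < S.ρ ω} := by ext; simp
  rw [← h2, h, ENNReal.toReal_sub_of_le prob_le_one ENNReal.one_ne_top]
  simp [FdistE]

/-- Among events of a given probability, upper level sets of `ρ` have the largest cost, and are
essentially the only ones to do so. -/
lemma BSetup.cost_le_of_measure_eq (S : BSetup Ω) {B : Set Ω} (hB : MeasurableSet B) {x : ℝ}
    (h : S.P B = S.P {ω | x < S.ρ ω}) :
    S.cost B ≤ S.cost {ω | x < S.ρ ω} ∧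
      (S.cost {ω | x < S.ρ ω} ≤ S.cost B → B =ᵐ[S.P] {ω | x < S.ρ ω}) := by
  set C := {ω | x < S.ρ ω} with hC
  have hCm : MeasurableSet C := measurableSet_lt measurable_const S.meas_ρ
  set g : Ω → ℝ := fun ω => S.ρ ω - x
  have hg : Integrable g S.P := S.ρ_int.sub (integrable_const x)
  set f : Ω → ℝ := fun ω => C.indicator g ω - B.indicator g ω
  have hf : Integrable f S.P := (hg.indicator hCm).sub (hg.indicator hB)
  have hf0 : 0 ≤ f := by
    intro ω
    by_cases h1 : x < S.ρ ω <;> by_cases h2 : ω ∈ B <;>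
      simp [f, g, hC, h1, h2] <;> linarith
  have hset : ∀ A, MeasurableSet A →
      ∫ ω, A.indicator g ω ∂S.P = ∫ ω in A, S.ρ ω ∂S.P - (S.P A).toReal * x := by
    intro A hA
    rw [integral_indicator hA, integral_sub S.ρ_int.integrableOn (integrable_const x)]
    simp [Measure.real]
  have hfi : ∫ ω, f ω ∂S.P = ∫ ω in C, S.ρ ω ∂S.P - ∫ ω in B, S.ρ ω ∂S.P := by
    rw [integral_sub (hg.indicator hCm) (hg.indicator hB), hset C hCm, hset B hB, h]
    ring
  have hnn : 0 ≤ ∫ ω, f ω ∂S.P := integral_nonneg hf0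
  rw [S.cost_apply hB, S.cost_apply hCm]
  refine ⟨ENNReal.ofReal_le_ofReal (by linarith), fun hle => ?_⟩
  rw [ENNReal.ofReal_le_ofReal_iff (S.setIntegral_nonneg _)] at hle
  have hz : f =ᵐ[S.P] 0 := (integral_eq_zero_iff_of_nonneg hf0 hf).1 (by linarith)
  have hne : ∀ᵐ ω ∂S.P, S.ρ ω ≠ x := by
    rw [ae_iff]
    simpa using S.ρ_atomless x
  refine eventuallyEq_set.2 ?_
  filter_upwards [hz, hne] with ω h1 h2
  have h3 : S.ρ ω - x ≠ 0 := sub_ne_zero.2 h2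
  have h4 : C.indicator g ω - B.indicator g ω = 0 := h1
  by_cases hb : ω ∈ B <;> by_cases hc : ω ∈ C <;> simp only [hb, hc]
  · exact (h3 (by simpa [hb, hc] using h4)).elim
  · exact (h3 (by simpa [hb, hc] using h4)).elim

/-- The survival function of `ρ` attains every value in `(0, P{ρ > c}]` on `[c, ∞)`. -/
lemma BSetup.exists_level (S : BSetup Ω) {c : ℝ} {p : ℝ≥0∞} (hp : p ≠ 0)
    (hpc : p ≤ S.P {ω | c < S.ρ ω}) : ∃ x : ℝ, c ≤ x ∧ S.P {ω | x < S.ρ ω} = p := by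
  have : IsProbabilityMeasure (S.P.map S.ρ) := Measure.isProbabilityMeasure_map S.meas_ρ.aemeasurable
  set F := ProbabilityTheory.cdf (S.P.map S.ρ) with hF
  have hcont : Continuous F := by
    rw [continuous_iff_continuousAt]
    intro a
    rw [F.mono.continuousAt_iff_leftLim_eq_rightLim, F.rightLim_eq]
    have h1 : F.measure {a} = 0 := by
      rw [hF, ProbabilityTheory.measure_cdf, Measure.map_apply S.meas_ρ (measurableSet_singleton a)]
      exact S.ρ_atomless a
    rw [F.measure_singleton, ENNReal.ofReal_eq_zero] at h1
    exact le_antisymm (F.mono.leftLim_le le_rfl) (by linarith)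
  have hlt : ∀ y, S.P {ω | y < S.ρ ω} = ENNReal.ofReal (1 - F y) := by
    intro y
    rw [show {ω | y < S.ρ ω} = S.ρ ⁻¹' Ioi y from rfl,
      ← Measure.map_apply S.meas_ρ measurableSet_Ioi, ← ProbabilityTheory.measure_cdf (S.P.map S.ρ),
      StieltjesFunction.measure_Ioi _ (ProbabilityTheory.tendsto_cdf_atTop _)]
  have hptop : p ≠ ⊤ := (hpc.trans_lt (measure_lt_top _ _)).ne
  have hp0 : 0 < p.toReal := ENNReal.toReal_pos hp hptop
  have h1 : F c ≤ 1 - p.toReal := by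
    rw [hlt] at hpc
    have := ENNReal.toReal_mono ENNReal.ofReal_ne_top hpc
    rw [ENNReal.toReal_ofReal (sub_nonneg.2 (ProbabilityTheory.cdf_le_one _ _))] at this
    linarith
  obtain ⟨R, hR⟩ := ((ProbabilityTheory.tendsto_cdf_atTop (S.P.map S.ρ)).eventually
    (lt_mem_nhds (show 1 - p.toReal < 1 by linarith))).exists
  have hcR : c ≤ R := by
    by_contra hcon
    have := F.mono (not_le.1 hcon).le
    linarith
  obtain ⟨x, hx, hxe⟩ := intermediate_value_Icc hcR hcont.continuousOn
    (show 1 - p.toReal ∈ Icc (F c) (F R) from ⟨h1, hR.le⟩)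
  refine ⟨x, hx.1, ?_⟩
  rw [hlt, hxe, sub_sub_cancel, ENNReal.ofReal_toReal hptop]

lemma BSetup.measure_gt_pos (S : BSetup Ω) {x : ℝ} (hx : (x : EReal) < rhoBar S) :
    S.P {ω | x < S.ρ ω} ≠ 0 := by
  intro h
  refine absurd hx (not_lt.2 (essSup_le_of_ae_le _ ?_))
  have : ∀ᵐ ω ∂S.P, ¬ x < S.ρ ω := by
    rw [ae_iff]
    simpa using h
  filter_upwards [this] with ω hω
  exact_mod_cast not_lt.1 hω

lemma BSetup.lt_rhoBar (S : BSetup Ω) {x : ℝ} (hx : S.P {ω | x < S.ρ ω} ≠ 0) :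
    (x : EReal) < rhoBar S := by
  by_contra h
  apply hx
  have : ∀ᵐ ω ∂S.P, ¬ x < S.ρ ω := by
    filter_upwards [ae_le_essSup (f := fun ω => (S.ρ ω : EReal)) (μ := S.P)] with ω hω
    exact not_lt.2 (by exact_mod_cast hω.trans (not_lt.1 h))
  rw [ae_iff] at this
  simpa using this

lemma ERhoGt_coe_pos (S : BSetup Ω) {x : ℝ} (hx : (x : EReal) < rhoBar S) : 0 < ERhoGt S x := by
  rw [ERhoGt_coe_eq_cost]
  exact ENNReal.toReal_pos (fun h => S.measure_gt_pos hx (S.ac_cost h)) (measure_ne_top _ _)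

/-- Jensen's inequality for a sub-probability weight, with strictness if mass is missing. -/
lemma setLIntegral_perspective_le_volume {u : ℝ → ℝ} (hu : ConcaveOn ℝ (Ici 0) u)
    (hm : StrictMonoOn u (Ici 0)) (h0 : u 0 = 0) (hs : StrictConcaveAtZero u)
    {D : Set ℝ} (hD : MeasurableSet D) {w : ℝ → ℝ} (hw : Measurable w)
    (hwpos : ∀ t ∈ D, 0 < w t) (hDtop : volume D ≠ ⊤)
    (hle : ∫⁻ t in D, ENNReal.ofReal (w t) ≤ 1) :
    ∫⁻ t in D, ENNReal.ofReal (u (1 / w t) * w t) ≤ ENNReal.ofReal (u (volume D).toReal) ∧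
      (volume D ≠ 0 → ∫⁻ t in D, ENNReal.ofReal (w t) < 1 →
        ∫⁻ t in D, ENNReal.ofReal (u (1 / w t) * w t) <
          ENNReal.ofReal (u (volume D).toReal)) := by
  rcases eq_or_ne (volume D) 0 with hD0 | hD0
  · exact ⟨by rw [setLIntegral_measure_zero _ _ hD0]; exact zero_le, fun h => (h hD0).elim⟩
  set s := (volume D).toReal with hsdef
  have hspos : 0 < s := ENNReal.toReal_pos hD0 hDtop
  set L := ∫⁻ t in D, ENNReal.ofReal (w t) with hL
  have hLtop : L ≠ ⊤ := (hle.trans_lt ENNReal.one_lt_top).ne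
  have hL0 : L ≠ 0 := by
    intro h
    rw [hL, setLIntegral_eq_zero_iff hD hw.ennreal_ofReal] at h
    apply hD0
    have h2 : ∀ᵐ t, t ∉ D := by
      filter_upwards [h] with t ht htD
      have := ht htD
      rw [ENNReal.ofReal_eq_zero] at this
      exact absurd (hwpos t htD) (not_lt.2 this)
    rw [ae_iff] at h2
    simpa using h2
  have hlpos : 0 < L.toReal := ENNReal.toReal_pos hL0 hLtop
  have hl1 : L.toReal ≤ 1 := by simpa using ENNReal.toReal_mono ENNReal.one_ne_top hle
  have hmain := setLIntegral_perspective_le hu hm h0 hD hw hwpos hspos hlpos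
    (ENNReal.ofReal_toReal hDtop).symm (ENNReal.ofReal_toReal hLtop).symm
  have hstrict : L.toReal < 1 → L.toReal * u (s / L.toReal) < u s := by
    intro h
    have := hs (s / L.toReal) (div_pos hspos hlpos) L.toReal hlpos h
    rwa [mul_div_cancel₀ _ hlpos.ne'] at this
  refine ⟨hmain.trans (ENNReal.ofReal_le_ofReal ?_), fun _ h => hmain.trans_lt ?_⟩
  · rcases hl1.lt_or_eq with h | h
    · exact (hstrict h).le
    · rw [h]; simp
  · rw [ENNReal.ofReal_lt_ofReal_iff (hm.pos_of_zero h0 hspos)]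
    exact hstrict (by simpa using (ENNReal.toReal_lt_toReal hLtop ENNReal.one_ne_top).2 h)

lemma Vmn_layercake (S : BSetup Ω) (Y : Ω → ℝ) :
    Vmn S Y = ∫⁻ z in Ioi (0 : ℝ),
      volume ({y | z < S.Tm (S.P {ω | y < S.um (Y ω)}).toReal} ∩ Ioi 0) := by
  have hanti : Antitone fun y => S.Tm (S.P {ω | y < S.um (Y ω)}).toReal := fun y y' h =>
    S.Tm_mono_measure (measure_mono fun ω hω => lt_of_le_of_lt h hω)
  rw [Vmn, lintegral_eq_lintegral_meas_lt _ (ae_of_all _ fun y => S.Tm_nonneg_measure _)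
    hanti.measurable.aemeasurable]
  refine lintegral_congr fun z => ?_
  rw [Measure.restrict_apply (measurableSet_lt measurable_const hanti.measurable)]

/-- Quantiles of `u₋(Y)` dominate `u₋` of the quantiles of `Y`. -/
lemma ofReal_um_volume_le (S : BSetup Ω) {Y : Ω → ℝ} {z : ℝ}
    (htop : volume ({t | z < S.Tm (S.P {ω | t < Y ω}).toReal} ∩ Ioi 0) ≠ ⊤) :
    ENNReal.ofReal (S.um
        (volume ({t | z < S.Tm (S.P {ω | t < Y ω}).toReal} ∩ Ioi 0)).toReal) ≤
      volume ({y | z < S.Tm (S.P {ω | y < S.um (Y ω)}).toReal} ∩ Ioi 0) := by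
  set D := {t | z < S.Tm (S.P {ω | t < Y ω}).toReal} ∩ Ioi 0 with hDdef
  rcases eq_or_ne (volume D) 0 with hD0 | hD0
  · simp [hD0, S.um_zero]
  have hspos : 0 < (volume D).toReal := ENNReal.toReal_pos hD0 htop
  have hsub : Ioo 0 (S.um (volume D).toReal) ⊆
      {y | z < S.Tm (S.P {ω | y < S.um (Y ω)}).toReal} ∩ Ioi 0 := by
    intro y hy
    refine ⟨?_, hy.1⟩
    obtain ⟨r, hr0, hrs, hyr⟩ := exists_lt_of_lt_concave S.um_concave hspos hy.2
    have hex : ∃ t ∈ D, r < t := by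
      by_contra! hcon
      have h1 : D ⊆ Ioc 0 r := fun t ht => ⟨ht.2, hcon t ht⟩
      have h2 := measure_mono (μ := volume) h1
      rw [Real.volume_Ioc, sub_zero] at h2
      have h3 := ENNReal.toReal_mono ENNReal.ofReal_ne_top h2
      rw [ENNReal.toReal_ofReal hr0.le] at h3
      linarith
    obtain ⟨t, ⟨htz, ht0⟩, hrt⟩ := hex
    refine lt_of_lt_of_le htz (S.Tm_mono_measure (measure_mono fun ω hω => ?_))
    have h4 : r < Y ω := hrt.trans hω
    exact hyr.trans (S.um_mono hr0.le (hr0.trans h4).le h4)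
  calc _ = volume (Ioo 0 (S.um (volume D).toReal)) := by rw [Real.volume_Ioo, sub_zero]
    _ ≤ _ := measure_mono hsub

/-- If `v` is a lower bound for the values of all admissible step claims of price `a`, then it is
one for the step claim of price `a` on any event `B` contained in `{ρ > c}`. -/
lemma exists_level_of_le_step (S : BSetup Ω) {c a : ℝ} (ha : 0 < a) {v : ℝ≥0∞}
    (hv : ∀ x : ℝ, c ≤ x → (x : EReal) < rhoBar S →
      v ≤ ENNReal.ofReal (S.um (a / ERhoGt S x) * S.Tm (1 - FdistE S x)))
    {B : Set Ω} (hB : MeasurableSet B) (hB0 : S.P B ≠ 0) (hBc : S.P B ≤ S.P {ω | c < S.ρ ω}) :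
    v ≤ ENNReal.ofReal (S.um (a / (S.cost B).toReal) * S.Tm (S.P B).toReal) ∧
      (ENNReal.ofReal (S.um (a / (S.cost B).toReal) * S.Tm (S.P B).toReal) ≤ v →
        ∃ x : ℝ, c ≤ x ∧ (x : EReal) < rhoBar S ∧ B =ᵐ[S.P] {ω | x < S.ρ ω}) := by
  obtain ⟨x, hcx, hx⟩ := S.exists_level hB0 hBc
  have hxr : (x : EReal) < rhoBar S := S.lt_rhoBar (hx ▸ hB0)
  obtain ⟨hle, heq⟩ := S.cost_le_of_measure_eq hB hx.symm
  have hE := ERhoGt_coe_pos S hxr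
  have hQ : 0 < (S.cost B).toReal :=
    ENNReal.toReal_pos (fun h => hB0 (S.ac_cost h)) (measure_ne_top _ _)
  have hT : 0 < S.Tm (S.P B).toReal := by
    have := S.Tm_lt_measure (A := ∅) (B := B) (by simpa using pos_iff_ne_zero.2 hB0)
    simpa [S.Tm_zero] using this
  have hvx := hv x hcx hxr
  rw [one_sub_FdistE_coe, hx] at hvx
  have hle' : (S.cost B).toReal ≤ ERhoGt S x := by
    rw [ERhoGt_coe_eq_cost]
    exact ENNReal.toReal_mono (measure_ne_top _ _) hle
  refine ⟨hvx.trans (ENNReal.ofReal_le_ofReal (mul_le_mul_of_nonneg_right ?_ hT.le)), fun h => ?_⟩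
  · exact S.um_mono.monotoneOn (div_pos ha hE).le (div_pos ha hQ).le
      (div_le_div_of_nonneg_left ha.le hQ hle')
  · refine ⟨x, hcx, hxr, heq ?_⟩
    have h1 := h.trans hvx
    rw [ENNReal.ofReal_le_ofReal_iff (mul_nonneg
      (S.um_mono.nonneg_of_zero S.um_zero (div_pos ha hE).le) hT.le)] at h1
    have h2 := (S.um_mono.le_iff_le (div_pos ha hQ).le (div_pos ha hE).le).1
      (le_of_mul_le_mul_right h1 hT)
    rw [div_le_div_iff_of_pos_left ha hQ hE, ERhoGt_coe_eq_cost] at h2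
    exact (ENNReal.toReal_le_toReal (measure_ne_top _ _) (measure_ne_top _ _)).1 h2

lemma measure_level_le (S : BSetup Ω) {c : ℝ} {Y : Ω → ℝ}
    (hYc : ∀ᵐ ω ∂S.P, S.ρ ω ≤ c → Y ω = 0) {t : ℝ} (ht : 0 ≤ t) :
    S.P {ω | t < Y ω} ≤ S.P {ω | c < S.ρ ω} := by
  refine measure_mono_ae ?_
  filter_upwards [hYc] with ω hω hω2
  by_contra hcon
  exact absurd (hω (not_lt.1 hcon)) (ht.trans_lt hω2).ne'

/-- A claim at least as good as every admissible step claim has a constant survival function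
strictly below its essential supremum. -/
lemma measure_level_eq_of_optimal (S : BSetup Ω) (hum : StrictConcaveAtZero S.um) {c a : ℝ}
    (ha : 0 < a) {Y : Ω → ℝ} (hYm : Measurable Y) (hY0 : ∀ ω, 0 ≤ Y ω)
    {b : ℝ} (hYb : ∀ᵐ ω ∂S.P, Y ω ≤ b) (hYc : ∀ᵐ ω ∂S.P, S.ρ ω ≤ c → Y ω = 0)
    (hYa : ∫⁻ ω, ENNReal.ofReal (Y ω) ∂S.cost = ENNReal.ofReal a) (hfin : Vmn S Y ≠ ⊤)
    (hopt : ∀ x : ℝ, c ≤ x → (x : EReal) < rhoBar S →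
      Vmn S Y ≤ ENNReal.ofReal (S.um (a / ERhoGt S x) * S.Tm (1 - FdistE S x)))
    {t₁ t₂ t₃ : ℝ} (h01 : 0 < t₁) (h12 : t₁ < t₂) (h23 : t₂ < t₃)
    (h3 : S.P {ω | t₃ < Y ω} ≠ 0) : S.P {ω | t₁ < Y ω} = S.P {ω | t₂ < Y ω} := by
  have hlev : ∀ t, MeasurableSet {ω | t < Y ω} := fun t => measurableSet_lt measurable_const hYm
  have hanti : ∀ (μ : Measure Ω) {s t : ℝ}, s ≤ t → μ {ω | t < Y ω} ≤ μ {ω | s < Y ω} :=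
    fun μ s t h => measure_mono fun ω hω => h.trans_lt hω
  set TG : ℝ → ℝ := fun t => S.Tm (S.P {ω | t < Y ω}).toReal with hTG
  have hTGanti : Antitone TG := fun s t h => S.Tm_mono_measure (hanti _ h)
  set w : ℝ → ℝ := fun t => (S.cost {ω | t < Y ω}).toReal / a with hwdef
  have hwanti : Antitone w := fun s t h =>
    div_le_div_of_nonneg_right (ENNReal.toReal_mono (measure_ne_top _ _) (hanti _ h)) ha.le
  have hwm : Measurable w := hwanti.measurable
  have hw0 : ∀ t, 0 ≤ w t := fun t => div_nonneg ENNReal.toReal_nonneg ha.le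
  have hwpos : ∀ t, S.P {ω | t < Y ω} ≠ 0 → 0 < w t := fun t ht =>
    div_pos (ENNReal.toReal_pos (fun h => ht (S.ac_cost h)) (measure_ne_top _ _)) ha
  have hwint : ∫⁻ t in Ioi (0 : ℝ), ENNReal.ofReal (w t) = 1 := by
    rw [lintegral_eq_lintegral_meas_lt _ (ae_of_all _ hY0) hYm.aemeasurable] at hYa
    have : ∀ t, ENNReal.ofReal (w t) = S.cost {ω | t < Y ω} * (ENNReal.ofReal a)⁻¹ := by
      intro t
      rw [hwdef, ENNReal.ofReal_div_of_pos ha, ENNReal.ofReal_toReal (measure_ne_top _ _),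
        div_eq_mul_inv]
    simp_rw [this]
    rw [lintegral_mul_const' _ _ (ENNReal.inv_ne_top.2 (by simpa using ha)), hYa,
      ENNReal.mul_inv_cancel (by simpa using ha) ENNReal.ofReal_ne_top]
  set D : ℝ → Set ℝ := fun z => {t | z < TG t} ∩ Ioi 0 with hD
  have hDm : ∀ z, MeasurableSet (D z) := fun z =>
    (measurableSet_lt measurable_const hTGanti.measurable).inter measurableSet_Ioi
  have hPpos : ∀ z, 0 < z → ∀ t ∈ D z, S.P {ω | t < Y ω} ≠ 0 := by
    intro z hz t ht h
    have : z < TG t := ht.1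
    simp [hTG, h, S.Tm_zero] at this
    linarith
  have hDb : ∀ z, 0 < z → D z ⊆ Ioc 0 b := by
    intro z hz t ht
    refine ⟨ht.2, ?_⟩
    by_contra hcon
    refine hPpos z hz t ht ?_
    rw [← nonpos_iff_eq_zero, ← show S.P {ω | ¬ Y ω ≤ b} = 0 from ae_iff.1 hYb]
    exact measure_mono fun ω hω => not_le.2 ((not_le.1 hcon).trans hω)
  have hDtop : ∀ z, 0 < z → volume (D z) ≠ ⊤ := fun z hz =>
    ((measure_mono (hDb z hz)).trans_lt (by simp [Real.volume_Ioc])).ne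
  set k : ℝ → ℝ≥0∞ := fun t => ENNReal.ofReal (S.um (1 / w t) * w t) with hk
  have hkm : Measurable k := by
    have h1 : Monotone fun x : ℝ => S.um (max x 0) := fun x y h =>
      S.um_mono.monotoneOn (mem_Ici.2 (le_max_right _ _)) (mem_Ici.2 (le_max_right _ _))
      (max_le_max_right _ h)
    have h2 : k = fun t => ENNReal.ofReal (S.um (max (1 / w t) 0) * w t) := by
      funext t
      rw [hk, max_eq_left (one_div_nonneg.2 (hw0 t))]
    rw [h2]
    exact ((h1.measurable.comp (measurable_const.div hwm)).mul hwm).ennreal_ofReal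
  have hDle : ∀ z, ∫⁻ t in D z, ENNReal.ofReal (w t) ≤ 1 := fun z =>
    hwint ▸ lintegral_mono_set inter_subset_right
  have hJ : ∀ z : ℝ, 0 < z → _ := fun z hz =>
    setLIntegral_perspective_le_volume S.um_concave S.um_mono S.um_zero hum (hDm z) hwm
      (fun t ht => hwpos t (hPpos z hz t ht)) (hDtop z hz) (hDle z)
  set N : ℝ → ℝ≥0∞ := fun z =>
    volume ({y | z < S.Tm (S.P {ω | y < S.um (Y ω)}).toReal} ∩ Ioi 0) with hN
  have hQN : ∀ z, 0 < z → ENNReal.ofReal (S.um (volume (D z)).toReal) ≤ N z := fun z hz =>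
    ofReal_um_volume_le S (hDtop z hz)
  have hNanti : Antitone N := fun z z' h =>
    measure_mono (inter_subset_inter_left _ fun y hy => h.trans_lt hy)
  have hV : Vmn S Y = ∫⁻ z in Ioi (0 : ℝ), N z := Vmn_layercake S Y
  have hVle : Vmn S Y ≤ ∫⁻ z in Ioi (0 : ℝ), ∫⁻ t in D z, k t := by
    have hstep : ∀ t ∈ Ioi (0 : ℝ),
        ENNReal.ofReal (w t) * Vmn S Y ≤ k t * ENNReal.ofReal (TG t) := by
      intro t ht
      rcases eq_or_ne (S.P {ω | t < Y ω}) 0 with h0 | h0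
      · simp [hwdef, S.cost_ac h0]
      · have hle := (exists_level_of_le_step S ha hopt (hlev t) h0
          (measure_level_le S hYc (le_of_lt ht))).1
        rw [show a / (S.cost {ω | t < Y ω}).toReal = 1 / w t by simp [hwdef]] at hle
        have hu := S.um_mono.nonneg_of_zero S.um_zero (one_div_nonneg.2 (hw0 t))
        calc _ ≤ ENNReal.ofReal (w t) * _ := mul_le_mul_right hle _
          _ = _ := by
            rw [hk, ← ENNReal.ofReal_mul (hw0 t), ← ENNReal.ofReal_mul (mul_nonneg hu (hw0 t))]
            congr 1
            ring
    calc Vmn S Y = ∫⁻ t in Ioi (0 : ℝ), ENNReal.ofReal (w t) * Vmn S Y := by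
          rw [lintegral_mul_const' _ _ hfin, hwint, one_mul]
      _ ≤ ∫⁻ t in Ioi (0 : ℝ), k t * ENNReal.ofReal (TG t) :=
          setLIntegral_mono' measurableSet_Ioi hstep
      _ = ∫⁻ t, ENNReal.ofReal (TG t) ∂((volume.restrict (Ioi 0)).withDensity k) := by
          rw [lintegral_withDensity_eq_lintegral_mul _ hkm hTGanti.measurable.ennreal_ofReal]
          rfl
      _ = ∫⁻ z in Ioi (0 : ℝ), ∫⁻ t in D z, k t := by
          rw [lintegral_eq_lintegral_meas_lt _ (ae_of_all _ fun t => S.Tm_nonneg_measure _)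
            hTGanti.measurable.aemeasurable]
          refine lintegral_congr fun z => ?_
          have hm : MeasurableSet {t | z < TG t} :=
            measurableSet_lt measurable_const hTGanti.measurable
          rw [withDensity_apply _ hm, Measure.restrict_restrict hm]
  by_contra hne
  have hlt : S.P {ω | t₂ < Y ω} < S.P {ω | t₁ < Y ω} :=
    lt_of_le_of_ne (hanti _ h12.le) (Ne.symm hne)
  have h2 : S.P {ω | t₂ < Y ω} ≠ 0 := fun h =>
    h3 (nonpos_iff_eq_zero.1 ((hanti _ h23.le).trans h.le))
  have hT2 : 0 < TG t₂ := by
    have := S.Tm_lt_measure (A := ∅) (B := {ω | t₂ < Y ω}) (by simpa using pos_iff_ne_zero.2 h2)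
    simpa [S.Tm_zero] using this
  have hT12 : TG t₂ < TG t₁ := S.Tm_lt_measure hlt
  have hMN : ∀ z, 0 < z → ∫⁻ t in D z, k t ≤ N z := fun z hz => (hJ z hz).1.trans (hQN z hz)
  have hMNlt : ∀ z ∈ Ico (TG t₂) (TG t₁), ∫⁻ t in D z, k t < N z := by
    intro z hz
    have hz0 : 0 < z := hT2.trans_le hz.1
    refine ((hJ z hz0).2 ?_ ?_).trans_le (hQN z hz0)
    · have hsub : Ioc 0 t₁ ⊆ D z := fun t ht => ⟨hz.2.trans_le (hTGanti ht.2), ht.1⟩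
      intro h
      have := measure_mono_null hsub h
      rw [Real.volume_Ioc] at this
      simp at this
      linarith
    · have hsub : D z ⊆ Iic t₂ := by
        intro t ht
        by_contra hcon
        exact absurd ht.1 (not_lt.2 ((hTGanti (not_le.1 hcon).le).trans hz.1))
      have hdisj : Disjoint (D z) (Ioc t₂ t₃) :=
        disjoint_left.2 fun t ht ht2 => absurd (hsub ht) (not_le.2 ht2.1)
      have hun : ∫⁻ t in D z ∪ Ioc t₂ t₃, ENNReal.ofReal (w t) ≤ 1 := by
        rw [← hwint]
        exact lintegral_mono_set (union_subset inter_subset_right fun t ht =>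
          (h01.trans h12).trans ht.1)
      rw [lintegral_union measurableSet_Ioc hdisj] at hun
      have hpos : 0 < ∫⁻ t in Ioc t₂ t₃, ENNReal.ofReal (w t) := by
        have hc : ∫⁻ t in Ioc t₂ t₃, ENNReal.ofReal (w t₃) ≤
            ∫⁻ t in Ioc t₂ t₃, ENNReal.ofReal (w t) :=
          setLIntegral_mono' measurableSet_Ioc fun t ht => ENNReal.ofReal_le_ofReal (hwanti ht.2)
        refine lt_of_lt_of_le ?_ hc
        rw [setLIntegral_const, Real.volume_Ioc]
        have h4 := hwpos t₃ h3
        exact ENNReal.mul_pos (by simpa using h4) (by simpa using h23)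
      exact (ENNReal.lt_add_right ((hDle z).trans_lt ENNReal.one_lt_top).ne hpos.ne').trans_le hun
  have hcontra : ∫⁻ z in Ioi (0 : ℝ), ∫⁻ t in D z, k t < ∫⁻ z in Ioi (0 : ℝ), N z := by
    have hae : (fun z => ∫⁻ t in D z, k t) ≤ᵐ[volume.restrict (Ioi 0)] N :=
      (ae_restrict_iff' measurableSet_Ioi).2 (ae_of_all _ fun z hz => hMN z hz)
    refine lintegral_strict_mono_of_ae_le_of_ae_lt_on hNanti.measurable.aemeasurable ?_ hae
      (s := Ico (TG t₂) (TG t₁)) ?_ (ae_of_all _ hMNlt)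
    · exact ((lintegral_mono_ae hae).trans_lt (hV ▸ hfin.lt_top)).ne
    · rw [Measure.restrict_apply measurableSet_Ico,
        inter_eq_left.2 (show Ico (TG t₂) (TG t₁) ⊆ Ioi 0 from fun z hz => hT2.trans_le hz.1),
        Real.volume_Ico]
      simpa using hT12
  exact absurd (hVle.trans_lt hcontra) (by rw [hV]; exact lt_irrefl _)

/-- A claim at least as good as every admissible step claim is itself an admissible step claim. -/
lemma eq_step_of_optimal (S : BSetup Ω) (hum : StrictConcaveAtZero S.um) {c a : ℝ}
    (ha : 0 < a) {Y : Ω → ℝ} (hYm : Measurable Y) (hY0 : ∀ ω, 0 ≤ Y ω)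
    {b : ℝ} (hYb : ∀ᵐ ω ∂S.P, Y ω ≤ b) (hYc : ∀ᵐ ω ∂S.P, S.ρ ω ≤ c → Y ω = 0)
    (hYa : ∫⁻ ω, ENNReal.ofReal (Y ω) ∂S.cost = ENNReal.ofReal a) (hfin : Vmn S Y ≠ ⊤)
    (hopt : ∀ x : ℝ, c ≤ x → (x : EReal) < rhoBar S →
      Vmn S Y ≤ ENNReal.ofReal (S.um (a / ERhoGt S x) * S.Tm (1 - FdistE S x))) :
    ∃ x : ℝ, c ≤ x ∧ (x : EReal) < rhoBar S ∧
      Y =ᵐ[S.P] {ω | x < S.ρ ω}.indicator fun _ => a / ERhoGt S x := by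
  set W : Set ℝ := {t | 0 ≤ t ∧ S.P {ω | t < Y ω} ≠ 0} with hW
  have hWb : ∀ t ∈ W, t ≤ b := by
    intro t ht
    by_contra hcon
    refine ht.2 (nonpos_iff_eq_zero.1 ?_)
    rw [← show S.P {ω | ¬ Y ω ≤ b} = 0 from ae_iff.1 hYb]
    exact measure_mono fun ω hω => not_le.2 ((not_le.1 hcon).trans hω)
  have hbdd : BddAbove W := ⟨b, hWb⟩
  have hP0 : S.P {ω | 0 < Y ω} ≠ 0 := by
    intro h
    have h1 : ∀ᵐ ω ∂S.cost, ENNReal.ofReal (Y ω) = 0 := by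
      have h2 : S.cost {ω | 0 < Y ω} = 0 := S.cost_ac h
      have h3 : ∀ᵐ ω ∂S.cost, ¬ 0 < Y ω := by rw [ae_iff]; simpa using h2
      exact h3.mono fun ω hω => ENNReal.ofReal_eq_zero.2 (not_lt.1 hω)
    rw [lintegral_congr_ae h1, lintegral_zero] at hYa
    exact absurd (ENNReal.ofReal_eq_zero.1 hYa.symm) (not_le.2 ha)
  have hW0 : (0 : ℝ) ∈ W := ⟨le_rfl, hP0⟩
  set s := sSup W with hs
  have habove : ∀ᵐ ω ∂S.P, Y ω ≤ s := by
    have h1 : ∀ q : ℚ, s < q → ∀ᵐ ω ∂S.P, ¬ (q : ℝ) < Y ω := by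
      intro q hq
      have h2 : (q : ℝ) ∉ W := fun h => absurd (le_csSup hbdd h) (not_le.2 hq)
      have h3 : S.P {ω | (q : ℝ) < Y ω} = 0 := by
        by_contra hcon
        exact h2 ⟨(le_csSup hbdd hW0).trans hq.le, hcon⟩
      rw [ae_iff]
      simpa using h3
    have h4 : ∀ᵐ ω ∂S.P, ∀ q : ℚ, s < q → ¬ (q : ℝ) < Y ω :=
      ae_all_iff.2 fun q => (ae_all_iff.2 (h1 q) : _)
    filter_upwards [h4] with ω hω
    by_contra hcon
    obtain ⟨q, hq1, hq2⟩ := exists_rat_btwn (not_le.1 hcon)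
    exact hω q hq1 hq2
  have hbelow : ∀ᵐ ω ∂S.P, 0 < Y ω → s ≤ Y ω := by
    have h1 : ∀ q r : ℚ, (0 : ℝ) < q ∧ (q : ℝ) < r ∧ (r : ℝ) < s →
        ∀ᵐ ω ∂S.P, ¬ ((q : ℝ) < Y ω ∧ Y ω ≤ r) := by
      rintro q r ⟨hq, hqr, hr⟩
      obtain ⟨t, htW, ht⟩ := exists_lt_of_lt_csSup ⟨0, hW0⟩ hr
      have h2 := measure_level_eq_of_optimal S hum ha hYm hY0 hYb hYc hYa hfin hopt hq hqr ht htW.2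
      rw [ae_iff]
      have h3 : {ω | ¬ ¬ ((q : ℝ) < Y ω ∧ Y ω ≤ r)} =
          {ω | (q : ℝ) < Y ω} \ {ω | (r : ℝ) < Y ω} := by
        ext ω
        simp
      rw [h3, measure_sdiff (show {ω | (r : ℝ) < Y ω} ⊆ {ω | (q : ℝ) < Y ω} from
          fun ω hω => hqr.trans hω)
        (measurableSet_lt measurable_const hYm).nullMeasurableSet (measure_ne_top _ _), h2,
        tsub_self]
    have h4 : ∀ᵐ ω ∂S.P, ∀ q r : ℚ, (0 : ℝ) < q ∧ (q : ℝ) < r ∧ (r : ℝ) < s →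
        ¬ ((q : ℝ) < Y ω ∧ Y ω ≤ r) :=
      ae_all_iff.2 fun q => ae_all_iff.2 fun r => (ae_all_iff.2 (h1 q r) : _)
    filter_upwards [h4] with ω hω hpos
    by_contra hcon
    obtain ⟨q, hq1, hq2⟩ := exists_rat_btwn hpos
    obtain ⟨r, hr1, hr2⟩ := exists_rat_btwn (not_le.1 hcon)
    exact hω q r ⟨hq1, hq2.trans hr1, hr2⟩ ⟨hq2, hr1.le⟩
  set B := {ω | 0 < Y ω} with hB
  have hBm : MeasurableSet B := measurableSet_lt measurable_const hYm
  have hY : Y =ᵐ[S.P] B.indicator fun _ => s := by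
    filter_upwards [habove, hbelow] with ω h1 h2
    by_cases h : 0 < Y ω
    · rw [indicator_of_mem (show ω ∈ B from h)]
      exact le_antisymm h1 (h2 h)
    · rw [indicator_of_notMem (show ω ∉ B from h)]
      exact le_antisymm (not_lt.1 h) (hY0 ω)
  have hs0 : 0 ≤ s := le_csSup hbdd hW0
  have hQ : 0 < (S.cost B).toReal :=
    ENNReal.toReal_pos (fun h => hP0 (S.ac_cost h)) (measure_ne_top _ _)
  have hsa : s = a / (S.cost B).toReal := by
    have h1 : ∫⁻ ω, ENNReal.ofReal (Y ω) ∂S.cost = ENNReal.ofReal s * S.cost B := by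
      rw [← lintegral_indicator_const hBm]
      refine lintegral_congr_ae ?_
      filter_upwards [S.cost_ac.ae_le hY] with ω hω
      rw [hω]
      by_cases h : ω ∈ B <;> simp [h]
    rw [h1] at hYa
    have h2 := congrArg ENNReal.toReal hYa
    rw [ENNReal.toReal_mul, ENNReal.toReal_ofReal hs0, ENNReal.toReal_ofReal ha.le] at h2
    rw [eq_div_iff hQ.ne', h2]
  have hVY : Vmn S Y = ENNReal.ofReal (S.um s * S.Tm (S.P B).toReal) := by
    rw [Vmn_congr S hY, Vmn_indicator S B hs0]
  obtain ⟨x, hcx, hxr, hx⟩ := (exists_level_of_le_step S ha hopt hBm hP0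
    (measure_level_le S hYc le_rfl)).2 (by rw [← hsa, hVY])
  refine ⟨x, hcx, hxr, hY.trans ?_⟩
  rw [ERhoGt_coe_eq_cost, ← measure_congr (S.cost_ac.ae_le hx), ← hsa]
  exact indicator_ae_eq_of_ae_eq_set hx

/-- The cost of a feasible claim, computed under the pricing measure. -/
lemma lintegral_cost_eq (S : BSetup Ω) {Y : Ω → ℝ} (hYm : Measurable Y) (hY0 : ∀ ω, 0 ≤ Y ω)
    (hint : Integrable (fun ω => S.ρ ω * Y ω) S.P) :
    ∫⁻ ω, ENNReal.ofReal (Y ω) ∂S.cost = ENNReal.ofReal (∫ ω, S.ρ ω * Y ω ∂S.P) := by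
  rw [BSetup.cost, lintegral_withDensity_eq_lintegral_mul _ S.meas_ρ.ennreal_ofReal
    hYm.ennreal_ofReal, ofReal_integral_eq_lintegral_ofReal hint]
  · refine lintegral_congr_ae ?_
    filter_upwards [S.ρ_pos] with ω hω
    exact (ENNReal.ofReal_mul hω.le).symm
  · filter_upwards [S.ρ_pos] with ω hω
    exact mul_nonneg hω.le (hY0 ω)

/-- The step claim paying its whole budget `xp - x0` on `{ρ > x}`. -/
def stepClaim (S : BSetup Ω) (xp x : ℝ) : Ω → ℝ :=
  {ω | x < S.ρ ω}.indicator fun _ => (xp - S.x0) / ERhoGt S x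

/-- The objective value of the step claim on `{ρ > x}`. -/
def stepValue (S : BSetup Ω) (xp : ℝ) (x : EReal) : ℝ :=
  S.um ((xp - S.x0) / ERhoGt S x) * S.Tm (1 - FdistE S x)

lemma mem_lev_coe (S : BSetup Ω) (c : ℝ) (ω : Ω) : ω ∈ lev S c ↔ S.ρ ω ≤ c :=
  EReal.coe_le_coe_iff

lemma budget_div_nonneg (S : BSetup Ω) {xp x : ℝ} (hxp : S.x0 ≤ xp)
    (hx : (x : EReal) < rhoBar S) : 0 ≤ (xp - S.x0) / ERhoGt S x :=
  div_nonneg (sub_nonneg.2 hxp) (ERhoGt_coe_pos S hx).le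

lemma feasNeg_stepClaim (S : BSetup Ω) {c xp x : ℝ} (hxp : S.x0 ≤ xp) (hcx : c ≤ x)
    (hx : (x : EReal) < rhoBar S) : FeasNeg S (lev S c) xp (stepClaim S xp x) := by
  have hk := budget_div_nonneg S hxp hx
  have hm : MeasurableSet {ω | x < S.ρ ω} := measurableSet_lt measurable_const S.meas_ρ
  have heq : (fun ω => S.ρ ω * stepClaim S xp x ω) =
      {ω | x < S.ρ ω}.indicator fun ω => S.ρ ω * ((xp - S.x0) / ERhoGt S x) := by
    funext ω
    by_cases h : ω ∈ {ω | x < S.ρ ω} <;> simp only [stepClaim, indicator, h] <;> simp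
  refine ⟨(measurable_const.indicator hm).aemeasurable,
    ae_of_all _ fun ω => indicator_nonneg (fun _ _ => hk) ω,
    ⟨(xp - S.x0) / ERhoGt S x, ae_of_all _ fun ω => indicator_le_self' (fun _ _ => hk) ω⟩, ?_, ?_,
    ae_of_all _ fun ω hω => indicator_of_notMem ?_ _⟩
  · rw [heq]
    exact (S.ρ_int.mul_const _).indicator hm
  · rw [heq, integral_indicator hm, integral_mul_const, ← ERhoGt_coe,
      mul_div_cancel₀ _ (ERhoGt_coe_pos S hx).ne']
  · exact not_lt.2 (((mem_lev_coe S c ω).1 hω).trans hcx)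

lemma Vmn_stepClaim (S : BSetup Ω) {xp x : ℝ} (hxp : S.x0 ≤ xp)
    (hx : (x : EReal) < rhoBar S) :
    Vmn S (stepClaim S xp x) = ENNReal.ofReal (stepValue S xp x) := by
  rw [stepClaim, Vmn_indicator S _ (budget_div_nonneg S hxp hx), stepValue, one_sub_FdistE_coe]

lemma stepValue_nonneg (S : BSetup Ω) {xp x : ℝ} (hxp : S.x0 ≤ xp)
    (hx : (x : EReal) < rhoBar S) : 0 ≤ stepValue S xp x := by
  rw [stepValue, one_sub_FdistE_coe]
  exact mul_nonneg (S.um_mono.nonneg_of_zero S.um_zero (budget_div_nonneg S hxp hx))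
    (S.Tm_nonneg_measure _)

/-- A feasible claim which does at least as well as every admissible step claim is one. -/
lemma ae_eq_stepClaim (S : BSetup Ω) (hum : StrictConcaveAtZero S.um) {c xp : ℝ}
    (hxp : S.x0 ≤ xp) (hc : (c : EReal) < rhoBar S) {X : Ω → ℝ}
    (hX : FeasNeg S (lev S c) xp X)
    (hopt : ∀ x : ℝ, c ≤ x → (x : EReal) < rhoBar S →
      Vmn S X ≤ ENNReal.ofReal (stepValue S xp x)) :
    ∃ x : ℝ, c ≤ x ∧ (x : EReal) < rhoBar S ∧ X =ᵐ[S.P] stepClaim S xp x := by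
  obtain ⟨hXm, hX0, ⟨b, hXb⟩, hXi, hXe, hXc⟩ := hX
  rcases hxp.eq_or_lt with rfl | hlt
  · refine ⟨c, le_rfl, hc, ?_⟩
    have h0 : 0 ≤ᵐ[S.P] fun ω => S.ρ ω * X ω := by
      filter_upwards [S.ρ_pos, hX0] with ω h1 h2
      exact mul_nonneg h1.le h2
    have h1 := (integral_eq_zero_iff_of_nonneg_ae h0 hXi).1 (by rw [hXe, sub_self])
    filter_upwards [h1, S.ρ_pos] with ω h2 h3
    have h4 : X ω = 0 := (mul_eq_zero.1 h2).resolve_left h3.ne'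
    simp [h4, stepClaim]
  set Y : Ω → ℝ := fun ω => max (hXm.mk X ω) 0 with hY
  have hXY : X =ᵐ[S.P] Y := by
    filter_upwards [hXm.ae_eq_mk, hX0] with ω h1 h2
    simp only [hY]
    rw [← h1, max_eq_left h2]
  have hYm : Measurable Y := hXm.measurable_mk.max measurable_const
  have hmul : (fun ω => S.ρ ω * X ω) =ᵐ[S.P] fun ω => S.ρ ω * Y ω := by
    filter_upwards [hXY] with ω h
    rw [h]
  have hY0 : ∀ ω, 0 ≤ Y ω := fun ω => le_max_right _ _
  have hYb : ∀ᵐ ω ∂S.P, Y ω ≤ b := by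
    filter_upwards [hXY, hXb] with ω h1 h2
    rwa [← h1]
  have hYc : ∀ᵐ ω ∂S.P, S.ρ ω ≤ c → Y ω = 0 := by
    filter_upwards [hXY, hXc] with ω h1 h2 h3
    rw [← h1, h2 ((mem_lev_coe S c ω).2 h3)]
  have hYa : ∫⁻ ω, ENNReal.ofReal (Y ω) ∂S.cost = ENNReal.ofReal (xp - S.x0) := by
    rw [lintegral_cost_eq S hYm hY0 (hXi.congr hmul), ← integral_congr_ae hmul, hXe]
  rw [Vmn_congr S hXY] at hopt
  obtain ⟨x, hcx, hx, h⟩ := eq_step_of_optimal S hum (sub_pos.2 hlt) hYm hY0 hYb hYc hYa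
    ((hopt c le_rfl hc).trans_lt ENNReal.ofReal_lt_top).ne hopt
  exact ⟨x, hcx, hx, hXY.trans h⟩

lemma rhoLow_nonneg (S : BSetup Ω) : 0 ≤ rhoLow S := by
  refine le_essInf_of_ae_le _ ?_
  filter_upwards [S.ρ_pos] with ω hω
  exact_mod_cast hω.le

lemma ae_mem_lev_rhoBar (S : BSetup Ω) : ∀ᵐ ω ∂S.P, ω ∈ lev S (rhoBar S) :=
  ae_le_essSup (f := fun ω => (S.ρ ω : EReal))

lemma measure_lev_rhoBar (S : BSetup Ω) : S.P (lev S (rhoBar S)) = 1 :=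
  (measure_eq_measure_of_null_sdiff (subset_univ _) (by
    rw [← compl_eq_univ_sdiff]
    exact ae_iff.1 (ae_mem_lev_rhoBar S))).trans measure_univ

lemma feasNeg_zero (S : BSetup Ω) (A : Set Ω) : FeasNeg S A S.x0 fun _ => 0 :=
  ⟨measurable_const.aemeasurable, ae_of_all _ fun _ => le_rfl, ⟨0, ae_of_all _ fun _ => le_rfl⟩,
    by simp, by simp, ae_of_all _ fun _ _ => rfl⟩

lemma Vmn_zero (S : BSetup Ω) : Vmn S (fun _ => 0) = 0 := by
  simpa [S.um_zero] using Vmn_indicator S univ (le_refl 0)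

lemma not_feasNeg_of_ae_mem (S : BSetup Ω) {A : Set Ω} (hA : ∀ᵐ ω ∂S.P, ω ∈ A) {xp : ℝ}
    (hxp : xp ≠ S.x0) (X : Ω → ℝ) : ¬ FeasNeg S A xp X := by
  rintro ⟨-, -, -, -, he, hX⟩
  rw [integral_eq_zero_of_ae] at he
  · exact hxp (sub_eq_zero.1 he.symm)
  · filter_upwards [hA, hX] with ω h1 h2
    simp [h2 h1]

lemma measure_lev_ne_one (S : BSetup Ω) {c : ℝ} (hc : (c : EReal) < rhoBar S) :
    S.P (lev S c) ≠ 1 := by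
  intro h
  have hm : MeasurableSet (lev S c) := by
    have : lev S c = {ω | S.ρ ω ≤ c} := Set.ext (mem_lev_coe S c)
    rw [this]
    exact measurableSet_le S.meas_ρ measurable_const
  refine S.measure_gt_pos hc ?_
  rw [← (prob_compl_eq_zero_iff hm).2 h]
  congr 1
  ext ω
  simp [mem_lev_coe]

/-- If every admissible step claim does at least as well as the one at `x`, the latter is
optimal. -/
lemma optNeg_stepClaim (S : BSetup Ω) (hum : StrictConcaveAtZero S.um) {c xp x : ℝ}
    (hxp : S.x0 ≤ xp) (hcx : c ≤ x) (hx : (x : EReal) < rhoBar S)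
    (hmin : ∀ y : ℝ, c ≤ y → (y : EReal) < rhoBar S → stepValue S xp x ≤ stepValue S xp y) :
    OptNeg S (lev S c) xp (stepClaim S xp x) := by
  refine ⟨feasNeg_stepClaim S hxp hcx hx, fun Y hY => ?_⟩
  rw [Vmn_stepClaim S hxp hx]
  by_contra hlt
  have hle := (not_le.1 hlt).le
  obtain ⟨y, hcy, hy, h⟩ := ae_eq_stepClaim S hum hxp
    (lt_of_le_of_lt (EReal.coe_le_coe_iff.2 hcx) hx) hY
    fun y hcy hy => hle.trans (ENNReal.ofReal_le_ofReal (hmin y hcy hy))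
  rw [Vmn_congr S h, Vmn_stepClaim S hxp hy] at hlt
  exact hlt (ENNReal.ofReal_le_ofReal (hmin y hcy hy))

/-- Every optimal claim is a step claim of minimal value. -/
lemma OptNeg.ae_eq_stepClaim (S : BSetup Ω) (hum : StrictConcaveAtZero S.um) {c xp : ℝ}
    (hxp : S.x0 ≤ xp) (hc : (c : EReal) < rhoBar S) {X : Ω → ℝ}
    (hX : OptNeg S (lev S c) xp X) :
    ∃ x : ℝ, c ≤ x ∧ (x : EReal) < rhoBar S ∧
      (∀ y : ℝ, c ≤ y → (y : EReal) < rhoBar S → stepValue S xp x ≤ stepValue S xp y) ∧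
      X =ᵐ[S.P] stepClaim S xp x := by
  have hopt : ∀ y : ℝ, c ≤ y → (y : EReal) < rhoBar S →
      Vmn S X ≤ ENNReal.ofReal (stepValue S xp y) := fun y hcy hy => by
    rw [← Vmn_stepClaim S hxp hy]
    exact hX.2 _ (feasNeg_stepClaim S hxp hcy hy)
  obtain ⟨x, hcx, hx, h⟩ := _root_.ae_eq_stepClaim S hum hxp hc hX.1 hopt
  refine ⟨x, hcx, hx, fun y hcy hy => ?_, h⟩
  have h1 := hopt y hcy hy
  rw [Vmn_congr S h, Vmn_stepClaim S hxp hx] at h1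
  exact (ENNReal.ofReal_le_ofReal_iff (stepValue_nonneg S hxp hy)).1 h1

lemma vNeg_lev_eq_sInf (S : BSetup Ω) (hum : StrictConcaveAtZero S.um) {c xp : ℝ}
    (hxp : S.x0 ≤ xp) (hc : (c : EReal) < rhoBar S) :
    vNeg S (lev S c) xp = sInf {v : EReal | ∃ x : ℝ, c ≤ x ∧ (x : EReal) < rhoBar S ∧
      v = (stepValue S xp x : EReal)} := by
  have hval : ∀ x : ℝ, (x : EReal) < rhoBar S →
      (Vmn S (stepClaim S xp x) : EReal) = (stepValue S xp x : EReal) := fun x hx => by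
    rw [Vmn_stepClaim S hxp hx, EReal.coe_ennreal_ofReal, max_eq_left (stepValue_nonneg S hxp hx)]
  rw [vNeg, if_neg (measure_lev_ne_one S hc)]
  refine le_antisymm (le_sInf ?_) (le_sInf ?_)
  · rintro _ ⟨x, hcx, hx, rfl⟩
    exact sInf_le ⟨_, feasNeg_stepClaim S hxp hcx hx, (hval x hx).symm⟩
  · rintro _ ⟨X, hX, rfl⟩
    by_contra hlt
    obtain ⟨x, hcx, hx, h⟩ := ae_eq_stepClaim S hum hxp hc hX fun y hcy hy => by
      rw [← Vmn_stepClaim S hxp hy, ← EReal.coe_ennreal_le_coe_ennreal_iff, hval y hy]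
      exact (not_le.1 hlt).le.trans (sInf_le ⟨y, hcy, hy, rfl⟩)
    refine hlt (sInf_le ⟨x, hcx, hx, ?_⟩)
    rw [Vmn_congr S h]
    exact hval x hx

/-- Theorem 7.1: solution of the negative part problem. -/
theorem negative_part_solution (S : BSetup Ω)
    (hum : StrictConcaveAtZero S.um)
    (c : EReal) (hc1 : rhoLow S ≤ c) (hc2 : c ≤ rhoBar S)
    (xp : ℝ) (hxp : max S.x0 0 ≤ xp) :
    -- (i)
    (c = rhoBar S → xp = S.x0 →
      OptNeg S (lev S c) xp (fun _ => 0) ∧ vNeg S (lev S c) xp = 0) ∧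
    -- (ii)
    (c = rhoBar S → xp ≠ S.x0 →
      (¬ ∃ X : Ω → ℝ, FeasNeg S (lev S c) xp X) ∧ vNeg S (lev S c) xp = ⊤) ∧
    -- (iii)
    (c < rhoBar S →
      vNeg S (lev S c) xp =
        sInf {v : EReal | ∃ cb : EReal, c ≤ cb ∧ cb < rhoBar S ∧
          v = ((S.um ((xp - S.x0) / ERhoGt S cb) * S.Tm (1 - FdistE S cb) : ℝ) : EReal)} ∧
      ((∃ X : Ω → ℝ, OptNeg S (lev S c) xp X) ↔
        (∃ cb : EReal, c ≤ cb ∧ cb < rhoBar S ∧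
          ∀ cb' : EReal, c ≤ cb' → cb' < rhoBar S →
            S.um ((xp - S.x0) / ERhoGt S cb) * S.Tm (1 - FdistE S cb) ≤
              S.um ((xp - S.x0) / ERhoGt S cb') * S.Tm (1 - FdistE S cb'))) ∧
      (∀ X : Ω → ℝ, OptNeg S (lev S c) xp X →
        ∃ cb : EReal, c ≤ cb ∧ cb < rhoBar S ∧
          (∀ cb' : EReal, c ≤ cb' → cb' < rhoBar S →
            S.um ((xp - S.x0) / ERhoGt S cb) * S.Tm (1 - FdistE S cb) ≤
              S.um ((xp - S.x0) / ERhoGt S cb') * S.Tm (1 - FdistE S cb')) ∧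
          (∀ᵐ ω ∂S.P, X ω =
            if cb < (S.ρ ω : EReal) then (xp - S.x0) / ERhoGt S cb else 0))) := by
  have hx0 : S.x0 ≤ xp := (le_max_left _ _).trans hxp
  refine ⟨?_, ?_, fun hc => ?_⟩
  · rintro rfl rfl
    exact ⟨⟨feasNeg_zero S _, fun Y _ => (Vmn_zero S).le.trans zero_le⟩,
      by rw [vNeg, if_pos (measure_lev_rhoBar S), if_pos rfl]⟩
  · rintro rfl hne
    exact ⟨fun ⟨X, hX⟩ => not_feasNeg_of_ae_mem S (ae_mem_lev_rhoBar S) hne X hX,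
      by rw [vNeg, if_pos (measure_lev_rhoBar S), if_neg hne]⟩
  have hbot : c ≠ ⊥ := ne_bot_of_le_ne_bot EReal.zero_ne_bot ((rhoLow_nonneg S).trans hc1)
  lift c to ℝ using ⟨hc.ne_top, hbot⟩
  have hreal : ∀ cb : EReal, (c : EReal) ≤ cb → cb < rhoBar S →
      ∃ x : ℝ, (x : EReal) = cb ∧ c ≤ x := fun cb h1 h2 =>
    have h := EReal.coe_toReal h2.ne_top (ne_bot_of_le_ne_bot (EReal.coe_ne_bot c) h1)
    ⟨cb.toReal, h, EReal.coe_le_coe_iff.1 (h.symm ▸ h1)⟩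
  have hmin : ∀ x : ℝ, (∀ y : ℝ, c ≤ y → (y : EReal) < rhoBar S →
      stepValue S xp x ≤ stepValue S xp y) → ∀ cb' : EReal, (c : EReal) ≤ cb' → cb' < rhoBar S →
      stepValue S xp x ≤ stepValue S xp cb' := by
    intro x h cb' h1 h2
    obtain ⟨y, rfl, hy⟩ := hreal cb' h1 h2
    exact h y hy h2
  have hform : ∀ X : Ω → ℝ, OptNeg S (lev S c) xp X → ∃ cb : EReal, (c : EReal) ≤ cb ∧
      cb < rhoBar S ∧ (∀ cb' : EReal, (c : EReal) ≤ cb' → cb' < rhoBar S →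
        stepValue S xp cb ≤ stepValue S xp cb') ∧
      ∀ᵐ ω ∂S.P, X ω = if cb < (S.ρ ω : EReal) then (xp - S.x0) / ERhoGt S cb else 0 := by
    intro X hX
    obtain ⟨x, hcx, hx, h1, h2⟩ := hX.ae_eq_stepClaim S hum hx0 hc
    refine ⟨x, EReal.coe_le_coe_iff.2 hcx, hx, hmin x h1, h2.mono fun ω hω => ?_⟩
    rw [hω]
    simp [stepClaim, indicator]
  refine ⟨?_, ⟨fun ⟨X, hX⟩ => ?_, ?_⟩, hform⟩
  · rw [vNeg_lev_eq_sInf S hum hx0 hc]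
    congr 1
    ext v
    constructor
    · rintro ⟨x, hcx, hx, rfl⟩
      exact ⟨x, EReal.coe_le_coe_iff.2 hcx, hx, rfl⟩
    · rintro ⟨cb, h1, h2, rfl⟩
      obtain ⟨x, rfl, hcx⟩ := hreal cb h1 h2
      exact ⟨x, hcx, h2, rfl⟩
  · obtain ⟨cb, h1, h2, h3, -⟩ := hform X hX
    exact ⟨cb, h1, h2, h3⟩
  · rintro ⟨cb, h1, h2, h3⟩
    obtain ⟨x, rfl, hcx⟩ := hreal cb h1 h2
    exact ⟨_, optNeg_stepClaim S hum hx0 hcx h2 fun y hcy hy =>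
      h3 y (EReal.coe_le_coe_iff.2 hcy) hy⟩

end
end

section
/- Problems (S_c) and (M) have the same supremum value (allowing the value +∞). -/
open MeasureTheory Set Filter
open scoped ENNReal symmDiff

noncomputable section

variable {Ω : Type*} [MeasurableSpace Ω]

/-- A concave nondecreasing function on `[0,∞)` has a nonnegative supergradient at every
interior point. -/
lemma ConcaveOn.exists_nonneg_supergradient {u : ℝ → ℝ} (hc : ConcaveOn ℝ (Ici 0) u)
    (hm : MonotoneOn u (Ici 0)) {t : ℝ} (ht : 0 < t) :
    ∃ p : ℝ, 0 ≤ p ∧ ∀ y, 0 ≤ y → u y ≤ u t + p * (y - t) := by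
  have hf : ConvexOn ℝ (Ici 0) (-u) := hc.neg
  have hti : t ∈ interior (Ici (0 : ℝ)) := by rwa [interior_Ici, mem_Ioi]
  set q := derivWithin (-u) (Ioi t) t with hq
  have key : ∀ y, 0 ≤ y → u y ≤ u t + (-q) * (y - t) := by
    intro y hy
    rcases lt_trichotomy y t with h | h | h
    · have h1 := (hf.slope_le_leftDeriv_of_mem_interior (mem_Ici.2 hy) hti h).trans
        (hf.leftDeriv_le_rightDeriv_of_mem_interior hti)
      rw [slope_def_field, div_le_iff₀ (by linarith)] at h1
      simp only [Pi.neg_apply] at h1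
      rw [← hq] at h1
      linarith
    · simp [h]
    · have h1 := hf.rightDeriv_le_slope_of_mem_interior hti (mem_Ici.2 hy) h
      rw [slope_def_field, le_div_iff₀ (by linarith)] at h1
      simp only [Pi.neg_apply] at h1
      rw [← hq] at h1
      linarith
  refine ⟨-q, ?_, key⟩
  have h1 := key (t + 1) (by linarith)
  have h2 := hm (mem_Ici.2 ht.le) (mem_Ici.2 (by linarith : (0 : ℝ) ≤ t + 1)) (by linarith)
  linarith

/-- Jensen-type bound: a concave function dominates the integral of its rescaled values. -/
lemma lintegral_perspective_le {u h : ℝ → ℝ} (hc : ConcaveOn ℝ (Ici 0) u)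
    (hm : MonotoneOn u (Ici 0)) (h0 : u 0 = 0) (hh : ∀ x, 0 ≤ h x) {k : ℝ} (hk : 0 < k)
    (hint : ∫⁻ x in Ioi (0 : ℝ), ENNReal.ofReal (h x) ≤ ENNReal.ofReal k) {t : ℝ} (ht : 0 < t) :
    ∫⁻ x in Ioc 0 t, ENNReal.ofReal (u (k / h x) * (h x / k)) ≤ ENNReal.ofReal (u t) := by
  obtain ⟨p, hp, hsup⟩ := hc.exists_nonneg_supergradient hm ht
  have ha : 0 ≤ u t - p * t := by
    have := hsup 0 le_rfl
    rw [h0] at this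
    linarith
  calc ∫⁻ x in Ioc 0 t, ENNReal.ofReal (u (k / h x) * (h x / k))
      ≤ ∫⁻ x in Ioc 0 t, (ENNReal.ofReal ((u t - p * t) / k) * ENNReal.ofReal (h x)
          + ENNReal.ofReal p) := by
        refine lintegral_mono fun x => ?_
        rw [← ENNReal.ofReal_mul (by positivity),
          ← ENNReal.ofReal_add (mul_nonneg (by positivity) (hh x)) hp]
        refine ENNReal.ofReal_le_ofReal ?_
        rcases (hh x).eq_or_lt with h1 | h1
        · simp [← h1, hp]
        · have h2 := mul_le_mul_of_nonneg_right (hsup (k / h x) (by positivity))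
            (by positivity : 0 ≤ h x / k)
          refine h2.trans (le_of_eq ?_)
          field_simp
          ring
    _ = ENNReal.ofReal ((u t - p * t) / k) * (∫⁻ x in Ioc 0 t, ENNReal.ofReal (h x))
          + ENNReal.ofReal p * ENNReal.ofReal t := by
        rw [lintegral_add_right _ measurable_const, lintegral_const_mul' _ _ ENNReal.ofReal_ne_top]
        simp
    _ ≤ ENNReal.ofReal ((u t - p * t) / k) * ENNReal.ofReal k
          + ENNReal.ofReal p * ENNReal.ofReal t := by
        gcongr
        exact (lintegral_mono_set Ioc_subset_Ioi_self).trans hint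
    _ = ENNReal.ofReal (u t) := by
        rw [← ENNReal.ofReal_mul (by positivity), ← ENNReal.ofReal_mul hp,
          ← ENNReal.ofReal_add (by positivity) (by positivity)]
        congr 1
        field_simp
        ring

/-- The measure of a lower set is bounded by any common bound for its initial segments. -/
lemma measure_le_of_forall_Iic_le (ν : Measure ℝ) {I : Set ℝ} (hI : IsLowerSet I) {C : ℝ≥0∞}
    (hC : ∀ x ∈ I, ν (Iic x) ≤ C) : ν I ≤ C := by
  by_cases hmax : ∃ x ∈ I, ∀ y ∈ I, y ≤ x
  · obtain ⟨x, hx, hy⟩ := hmax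
    exact (measure_mono fun y h => hy y h).trans (hC x hx)
  push Not at hmax
  have hsub : I ⊆ ⋃ q : {q : ℚ // (q : ℝ) ∈ I}, Iic (q.1 : ℝ) := by
    intro x hx
    obtain ⟨y, hy, hxy⟩ := hmax x hx
    obtain ⟨q, h1, h2⟩ := exists_rat_btwn hxy
    exact mem_iUnion.2 ⟨⟨q, hI h2.le hy⟩, h1.le⟩
  have hmono : Monotone fun q : {q : ℚ // (q : ℝ) ∈ I} => Iic (q.1 : ℝ) := fun a b h =>
    Iic_subset_Iic.2 (by exact_mod_cast h)
  refine (measure_mono hsub).trans ?_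
  rw [hmono.directed_le.measure_iUnion]
  exact iSup_le fun q => hC _ q.2

/-- Comparison of integrals of nonincreasing functions through their super-level sets. -/
lemma lintegral_le_of_superlevel {ν : Measure ℝ} {f g u : ℝ → ℝ} (hf : Antitone f)
    (hg : Antitone g) (hf0 : ∀ x, 0 ≤ f x) (hg0 : ∀ x, 0 ≤ g x) (hν0 : ν (Iic 0) = 0)
    (hν : ∀ x, 0 < x → ν (Iic x) ≤ ENNReal.ofReal (u x))
    (hfg : ∀ x y, 0 < x → 0 < y → y < u x → f x ≤ g y) :
    ∫⁻ x, ENNReal.ofReal (f x) ∂ν ≤ ∫⁻ y in Ioi (0 : ℝ), ENNReal.ofReal (g y) := by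
  rw [lintegral_eq_lintegral_meas_lt ν (.of_forall hf0) hf.measurable.aemeasurable,
    lintegral_eq_lintegral_meas_lt _ (.of_forall hg0) hg.measurable.aemeasurable]
  refine lintegral_mono fun t => ?_
  refine measure_le_of_forall_Iic_le ν (fun a b hab ha => lt_of_lt_of_le ha (hf hab)) ?_
  intro x hx
  rcases le_or_gt x 0 with h | h
  · rw [measure_mono_null (Iic_subset_Iic.2 h) hν0]
    exact zero_le
  · refine (hν x h).trans ?_
    have : ENNReal.ofReal (u x) = volume (Ioo 0 (u x)) := by simp
    rw [this, Measure.restrict_apply (measurableSet_lt measurable_const hg.measurable)]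
    exact measure_mono fun y hy => ⟨lt_of_lt_of_le hx (hfg x y h hy.1 hy.2), hy.1⟩

namespace BSetup

lemma Tm_nonneg (S : BSetup Ω) {p : ℝ} (hp : p ∈ Icc (0 : ℝ) 1) : 0 ≤ S.Tm p :=
  S.Tm_zero ▸ S.Tm_mono.monotoneOn (left_mem_Icc.2 zero_le_one) hp hp.1

lemma um_nonneg (S : BSetup Ω) {x : ℝ} (hx : 0 ≤ x) : 0 ≤ S.um x :=
  S.um_zero ▸ S.um_mono.monotoneOn self_mem_Ici (mem_Ici.2 hx) hx

lemma prob_mem_Icc (S : BSetup Ω) (A : Set Ω) : (S.P A).toReal ∈ Icc (0 : ℝ) 1 := by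
  have := S.isProb
  exact ⟨ENNReal.toReal_nonneg, measureReal_le_one⟩

lemma Tm_prob_mono (S : BSetup Ω) {A B : Set Ω} (h : A ≤ᵐ[S.P] B) :
    S.Tm (S.P A).toReal ≤ S.Tm (S.P B).toReal := by
  have := S.isProb
  exact S.Tm_mono.monotoneOn (S.prob_mem_Icc A) (S.prob_mem_Icc B)
    (ENNReal.toReal_mono (measure_ne_top _ _) (measure_mono_ae h))

/-- The measure with density `ρ` with respect to `P`. -/
def priced (S : BSetup Ω) : Measure Ω := S.P.withDensity fun ω => ENNReal.ofReal (S.ρ ω)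

lemma priced_ac (S : BSetup Ω) : S.priced ≪ S.P := withDensity_absolutelyContinuous _ _

lemma isFinite_priced (S : BSetup Ω) : IsFiniteMeasure S.priced :=
  isFiniteMeasure_withDensity_ofReal S.ρ_int.hasFiniteIntegral

lemma lintegral_priced_tail (S : BSetup Ω) {X : Ω → ℝ} (hX : AEMeasurable X S.P)
    (hX0 : ∀ᵐ ω ∂S.P, 0 ≤ X ω) (hi : Integrable (fun ω => S.ρ ω * X ω) S.P) :
    ∫⁻ x in Ioi (0 : ℝ), ENNReal.ofReal (S.priced {ω | x < X ω}).toReal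
      = ENNReal.ofReal (∫ ω, S.ρ ω * X ω ∂S.P) := by
  have := S.isFinite_priced
  simp only [ENNReal.ofReal_toReal (measure_ne_top S.priced _)]
  rw [← lintegral_eq_lintegral_meas_lt S.priced (S.priced_ac.ae_le hX0) (hX.mono_ac S.priced_ac),
    priced, lintegral_withDensity_eq_lintegral_mul₀ S.meas_ρ.ennreal_ofReal.aemeasurable
      hX.ennreal_ofReal, ofReal_integral_eq_lintegral_ofReal hi]
  · refine lintegral_congr_ae ?_
    filter_upwards [S.ρ_pos] with ω hω
    simp [ENNReal.ofReal_mul hω.le]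
  · filter_upwards [S.ρ_pos, hX0] with ω hω h
    positivity

/-- Lower bound for `V₋` from a uniform lower bound over the truncated step functions. -/
lemma ofReal_le_Vmn (S : BSetup Ω) {X : Ω → ℝ} (hX : AEMeasurable X S.P)
    (hX0 : ∀ᵐ ω ∂S.P, 0 ≤ X ω) (hi : Integrable (fun ω => S.ρ ω * X ω) S.P)
    {k m : ℝ} (hk : 0 < k) (hkX : ∫ ω, S.ρ ω * X ω ∂S.P = k) (hm : 0 ≤ m)
    (hb : ∀ x, 0 < x → 0 < (S.priced {ω | x < X ω}).toReal →
      m ≤ S.um (k / (S.priced {ω | x < X ω}).toReal) * S.Tm (S.P {ω | x < X ω}).toReal) :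
    ENNReal.ofReal m ≤ Vmn S X := by
  have := S.isProb
  have := S.isFinite_priced
  set h : ℝ → ℝ := fun x => (S.priced {ω | x < X ω}).toReal with hh
  set f : ℝ → ℝ := fun x => S.Tm (S.P {ω | x < X ω}).toReal with hf
  have htail : ∫⁻ x in Ioi (0 : ℝ), ENNReal.ofReal (h x) = ENNReal.ofReal k := by
    rw [← hkX]; exact S.lintegral_priced_tail hX hX0 hi
  have hh0 : ∀ x, 0 ≤ h x := fun x => ENNReal.toReal_nonneg
  have hhanti : Antitone h := fun a b hab => ENNReal.toReal_mono (measure_ne_top _ _)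
    (measure_mono fun ω hω => lt_of_le_of_lt hab hω)
  have hfanti : Antitone f := fun a b hab =>
    S.Tm_prob_mono (Eventually.of_forall fun ω hω => lt_of_le_of_lt hab hω)
  have hf0 : ∀ x, 0 ≤ f x := fun x => S.Tm_nonneg (S.prob_mem_Icc _)
  have humm : Monotone fun y => S.um (max 0 y) := fun a b hab =>
    S.um_mono.monotoneOn (le_max_left 0 a) (le_max_left 0 b) (max_le_max le_rfl hab)
  set w : ℝ → ℝ≥0∞ := fun x => ENNReal.ofReal (S.um (k / h x) * (h x / k)) with hw
  have hwm : Measurable w := by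
    have : w = fun x => ENNReal.ofReal (S.um (max 0 (k / h x)) * (h x / k)) := by
      funext x
      rw [max_eq_right (div_nonneg hk.le (hh0 x))]
    rw [this]
    exact ((humm.measurable.comp (measurable_const.div hhanti.measurable)).mul
      (hhanti.measurable.div_const k)).ennreal_ofReal
  have hνIic : ∀ x, ((volume.restrict (Ioi 0)).withDensity w) (Iic x)
      = ∫⁻ y in Ioc 0 x, w y := by
    intro x
    rw [withDensity_apply _ measurableSet_Iic, Measure.restrict_restrict measurableSet_Iic,
      inter_comm, Ioi_inter_Iic]
  have hmain : ∫⁻ x, ENNReal.ofReal (f x) ∂((volume.restrict (Ioi 0)).withDensity w)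
      ≤ Vmn S X := by
    refine lintegral_le_of_superlevel (u := S.um) hfanti ?_ hf0 ?_ ?_ ?_ ?_
    · exact fun a b hab =>
        S.Tm_prob_mono (Eventually.of_forall fun ω hω => lt_of_le_of_lt hab hω)
    · exact fun x => S.Tm_nonneg (S.prob_mem_Icc _)
    · simp [hνIic]
    · intro x hx
      rw [hνIic]
      exact lintegral_perspective_le S.um_concave S.um_mono.monotoneOn S.um_zero hh0 hk
        htail.le hx
    · intro x y hx _ hyx
      refine S.Tm_prob_mono ?_
      filter_upwards [hX0] with ω hω hlt
      exact lt_of_lt_of_le hyx (S.um_mono.monotoneOn (mem_Ici.2 hx.le) (mem_Ici.2 hω)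
        (le_of_lt hlt))
  refine le_trans ?_ hmain
  rw [lintegral_withDensity_eq_lintegral_mul _ hwm hfanti.measurable.ennreal_ofReal]
  calc ENNReal.ofReal m
      = ENNReal.ofReal (m / k) * ∫⁻ x in Ioi (0 : ℝ), ENNReal.ofReal (h x) := by
        rw [htail, ← ENNReal.ofReal_mul (by positivity), div_mul_cancel₀ _ hk.ne']
    _ = ∫⁻ x in Ioi (0 : ℝ), ENNReal.ofReal (m / k) * ENNReal.ofReal (h x) := by
        rw [lintegral_const_mul' _ _ ENNReal.ofReal_ne_top]
    _ ≤ _ := by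
        refine setLIntegral_mono (hwm.mul hfanti.measurable.ennreal_ofReal) fun x hx => ?_
        have hum : 0 ≤ S.um (k / h x) := S.um_nonneg (div_nonneg hk.le (hh0 x))
        rw [Pi.mul_apply, hw, ← ENNReal.ofReal_mul (by positivity),
          ← ENNReal.ofReal_mul (mul_nonneg hum (div_nonneg (hh0 x) hk.le))]
        refine ENNReal.ofReal_le_ofReal ?_
        rcases (hh0 x).eq_or_lt with h1 | h1
        · simp [← h1]
        · have h2 := mul_le_mul_of_nonneg_right (hb x hx h1) (by positivity : 0 ≤ h x / k)
          calc m / k * h x = m * (h x / k) := by ring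
            _ ≤ _ := h2
            _ = _ := by ring

lemma continuous_cdf_map_rho (S : BSetup Ω) : Continuous (ProbabilityTheory.cdf (S.P.map S.ρ)) := by
  have := S.isProb
  have : IsProbabilityMeasure (S.P.map S.ρ) :=
    Measure.isProbabilityMeasure_map S.meas_ρ.aemeasurable
  refine continuous_iff_continuousAt.2 fun a => ?_
  set F := ProbabilityTheory.cdf (S.P.map S.ρ) with hF
  have h1 : F.measure {a} = 0 := by
    rw [hF, ProbabilityTheory.measure_cdf, Measure.map_apply S.meas_ρ (measurableSet_singleton a)]
    exact S.ρ_atomless a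
  rw [StieltjesFunction.measure_singleton, ENNReal.ofReal_eq_zero] at h1
  rw [F.mono.continuousAt_iff_leftLim_eq_rightLim, F.rightLim_eq]
  exact le_antisymm (F.mono.leftLim_le le_rfl) (by linarith)

/-- Every tail probability between `0` and `P{ρ > c}` is attained by some `P{ρ > d}`, `d ≥ c`. -/
lemma exists_prob_rho_gt_eq (S : BSetup Ω) {c p : ℝ} (hp : 0 < p)
    (hpc : p ≤ (S.P {ω | c < S.ρ ω}).toReal) :
    ∃ d, c ≤ d ∧ (S.P {ω | d < S.ρ ω}).toReal = p := by
  have := S.isProb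
  have : IsProbabilityMeasure (S.P.map S.ρ) :=
    Measure.isProbabilityMeasure_map S.meas_ρ.aemeasurable
  have hcdf : ∀ x, (S.P {ω | x < S.ρ ω}).toReal = 1 - ProbabilityTheory.cdf (S.P.map S.ρ) x := by
    intro x
    rw [ProbabilityTheory.cdf_eq_real, Measure.real, Measure.map_apply S.meas_ρ measurableSet_Iic]
    have := prob_compl_eq_one_sub (μ := S.P)
      (S.meas_ρ measurableSet_Iic : MeasurableSet (S.ρ ⁻¹' Iic x))
    have h2 : (S.ρ ⁻¹' Iic x)ᶜ = {ω | x < S.ρ ω} := by ext; simp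
    rw [h2] at this
    rw [this, ENNReal.toReal_sub_of_le prob_le_one ENNReal.one_ne_top]
    simp
  rw [hcdf] at hpc
  obtain ⟨b, hb1, hb2⟩ := ((ProbabilityTheory.tendsto_cdf_atTop (S.P.map S.ρ)).eventually
    (lt_mem_nhds (by linarith : 1 - p < 1)) |>.and (eventually_ge_atTop c)).exists
  obtain ⟨d, hd, hd2⟩ := intermediate_value_Icc hb2 S.continuous_cdf_map_rho.continuousOn
    ⟨by linarith, hb1.le⟩
  exact ⟨d, hd.1, by rw [hcdf, hd2]; ring⟩

lemma priced_toReal (S : BSetup Ω) {A : Set Ω} (hA : NullMeasurableSet A S.P) :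
    (S.priced A).toReal = ∫ ω, A.indicator S.ρ ω ∂S.P := by
  rw [integral_indicator₀ hA, priced, withDensity_apply₀ _ hA, integral_eq_lintegral_of_nonneg_ae
    (ae_restrict_of_ae (S.ρ_pos.mono fun ω h => h.le)) S.ρ_int.aestronglyMeasurable.restrict]

lemma ERhoGt_coe (S : BSetup Ω) (d : ℝ) :
    ERhoGt S d = ∫ ω, {ω | d < S.ρ ω}.indicator S.ρ ω ∂S.P := by
  simp [ERhoGt, indicator_apply]

lemma lev_coe (S : BSetup Ω) (d : ℝ) : lev S d = {ω | S.ρ ω ≤ d} := by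
  simp [lev]

lemma measurableSet_rho_gt (S : BSetup Ω) (d : ℝ) : MeasurableSet {ω | d < S.ρ ω} :=
  measurableSet_lt measurable_const S.meas_ρ

lemma compl_lev_coe (S : BSetup Ω) (d : ℝ) : (lev S d)ᶜ = {ω | d < S.ρ ω} := by
  ext; simp [lev_coe]

lemma measurableSet_lev (S : BSetup Ω) (d : ℝ) : MeasurableSet (lev S d) :=
  S.lev_coe d ▸ measurableSet_le S.meas_ρ measurable_const

lemma one_sub_FdistE_coe (S : BSetup Ω) (d : ℝ) :
    1 - FdistE S d = (S.P {ω | d < S.ρ ω}).toReal := by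
  have := S.isProb
  rw [← compl_lev_coe, prob_compl_eq_one_sub (S.measurableSet_lev d),
    ENNReal.toReal_sub_of_le prob_le_one ENNReal.one_ne_top]
  simp [FdistE, lev]

lemma prob_lev_eq_one_iff (S : BSetup Ω) (d : ℝ) :
    S.P (lev S d) = 1 ↔ S.P {ω | d < S.ρ ω} = 0 := by
  have := S.isProb
  rw [← compl_lev_coe, prob_compl_eq_zero_iff (S.measurableSet_lev d)]

lemma ERhoGt_pos (S : BSetup Ω) {d : ℝ} (hd : S.P {ω | d < S.ρ ω} ≠ 0) : 0 < ERhoGt S d := by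
  rw [ERhoGt_coe, integral_indicator (S.measurableSet_rho_gt d),
    setIntegral_pos_iff_support_of_nonneg_ae (ae_restrict_of_ae (S.ρ_pos.mono fun ω h => h.le))
      S.ρ_int.integrableOn, pos_iff_ne_zero]
  rwa [measure_congr (t := {ω | d < S.ρ ω})]
  filter_upwards [S.ρ_pos] with ω hω
  exact propext ⟨fun h => h.2, fun h => ⟨hω.ne', h⟩⟩

/-- Among events of given probability, the tails of `ρ` have the largest price. -/
lemma priced_le_ERhoGt (S : BSetup Ω) {A : Set Ω} (hA : NullMeasurableSet A S.P) {d : ℝ}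
    (hP : (S.P {ω | d < S.ρ ω}).toReal = (S.P A).toReal) :
    (S.priced A).toReal ≤ ERhoGt S d := by
  have := S.isProb
  rw [S.priced_toReal hA, ERhoGt_coe]
  have hB := (S.measurableSet_rho_gt d).nullMeasurableSet (μ := S.P)
  have hi : Integrable (fun ω => S.ρ ω - d) S.P := S.ρ_int.sub (integrable_const d)
  have hsplit : ∀ {C : Set Ω}, NullMeasurableSet C S.P →
      ∫ ω, C.indicator (fun ω => S.ρ ω - d) ω ∂S.P
        = ∫ ω, C.indicator S.ρ ω ∂S.P - (S.P C).toReal * d := by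
    intro C hC
    rw [integral_indicator₀ hC, integral_indicator₀ hC,
      integral_sub S.ρ_int.integrableOn (integrable_const d)]
    simp [Measure.real]
  have hle : ∫ ω, A.indicator (fun ω => S.ρ ω - d) ω ∂S.P
      ≤ ∫ ω, {ω | d < S.ρ ω}.indicator (fun ω => S.ρ ω - d) ω ∂S.P := by
    refine integral_mono (hi.indicator₀ hA) (hi.indicator₀ hB) fun ω => ?_
    by_cases hA' : ω ∈ A <;> by_cases hB' : d < S.ρ ω <;>
      simp [hA', hB'] <;> linarith
  rw [hsplit hA, hsplit hB, hP] at hle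
  linarith

lemma vNeg_lev_le (S : BSetup Ω) {c : ℝ} {xp : ℝ} (hx : S.x0 ≤ xp)
    (hc : S.P {ω | c < S.ρ ω} ≠ 0) :
    vNeg S (lev S c) xp ≤
      ((S.um ((xp - S.x0) / ERhoGt S c) * S.Tm (1 - FdistE S c) : ℝ) : EReal) := by
  have hE := S.ERhoGt_pos hc
  rw [vNeg, if_neg (by rwa [prob_lev_eq_one_iff]), one_sub_FdistE_coe]
  set κ := (xp - S.x0) / ERhoGt S c with hκ
  have hκ0 : 0 ≤ κ := div_nonneg (by linarith) hE.le
  have hB := S.measurableSet_rho_gt c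
  set X : Ω → ℝ := {ω | c < S.ρ ω}.indicator fun _ => κ with hX
  have hmul : (fun ω => S.ρ ω * X ω) = fun ω => κ * {ω | c < S.ρ ω}.indicator S.ρ ω := by
    funext ω
    simp only [hX, indicator_apply]
    split_ifs <;> ring
  have hfeas : FeasNeg S (lev S c) xp X := by
    refine ⟨(measurable_const.indicator hB).aemeasurable, .of_forall fun ω => ?_,
      ⟨κ, .of_forall fun ω => ?_⟩, ?_, ?_, .of_forall fun ω hω => ?_⟩
    · exact indicator_nonneg (fun _ _ => hκ0) ω
    · exact indicator_le_self' (fun _ _ => hκ0) ω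
    · rw [hmul]
      exact (S.ρ_int.indicator hB).const_mul κ
    · rw [hmul, integral_const_mul, ← ERhoGt_coe, hκ, div_mul_cancel₀ _ hE.ne']
    · rw [lev_coe] at hω
      exact indicator_of_notMem (by simpa using hω) _
  have hV : Vmn S X ≤ ENNReal.ofReal (S.um κ * S.Tm (S.P {ω | c < S.ρ ω}).toReal) := by
    calc Vmn S X ≤ ∫⁻ y in Ioi (0 : ℝ), (Iio (S.um κ)).indicator
          (fun _ => ENNReal.ofReal (S.Tm (S.P {ω | c < S.ρ ω}).toReal)) y := by
          refine setLIntegral_mono (measurable_const.indicator measurableSet_Iio) fun y hy => ?_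
          rw [mem_Ioi] at hy
          by_cases h : y < S.um κ
          · rw [indicator_of_mem (mem_Iio.2 h)]
            refine ENNReal.ofReal_le_ofReal (S.Tm_prob_mono (.of_forall fun ω hω => ?_))
            by_contra hn
            have h1 : X ω = 0 := indicator_of_notMem (s := {ω | c < S.ρ ω}) hn _
            have h2 : y < S.um (X ω) := hω
            rw [h1, S.um_zero] at h2
            exact hy.not_gt h2
          · have : {ω | y < S.um (X ω)} = ∅ := by
              ext ω
              simp only [mem_ofPred_eq, mem_empty_iff_false, iff_false, not_lt]
              refine le_trans ?_ (not_lt.1 h)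
              exact S.um_mono.monotoneOn (mem_Ici.2 (indicator_nonneg (fun _ _ => hκ0) ω))
                (mem_Ici.2 hκ0) (indicator_le_self' (fun _ _ => hκ0) ω)
            simp [this, S.Tm_zero]
      _ = _ := by
          rw [lintegral_indicator_const measurableSet_Iio,
            Measure.restrict_apply measurableSet_Iio, inter_comm, Ioi_inter_Iio, Real.volume_Ioo,
            sub_zero, mul_comm, ENNReal.ofReal_mul (S.um_nonneg hκ0)]
  have hle : sInf {v : EReal | ∃ X : Ω → ℝ, FeasNeg S (lev S c) xp X ∧ v = (Vmn S X).toEReal}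
      ≤ (Vmn S X).toEReal := sInf_le (by exact ⟨X, hfeas, rfl⟩)
  refine hle.trans ?_
  rw [← EReal.coe_ennreal_le_coe_ennreal_iff] at hV
  refine hV.trans (le_of_eq ?_)
  rw [EReal.coe_ennreal_ofReal,
    max_eq_left (mul_nonneg (S.um_nonneg hκ0) (S.Tm_nonneg (S.prob_mem_Icc _)))]

lemma le_vNeg_lev (S : BSetup Ω) {c : ℝ} {xp : ℝ} (hx : S.x0 ≤ xp)
    (hc : S.P {ω | c < S.ρ ω} ≠ 0) {m : ℝ} (hm : 0 ≤ m)
    (hb : ∀ d : ℝ, c ≤ d → S.P {ω | d < S.ρ ω} ≠ 0 →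
      m ≤ S.um ((xp - S.x0) / ERhoGt S d) * S.Tm (1 - FdistE S d)) :
    (m : EReal) ≤ vNeg S (lev S c) xp := by
  have := S.isProb
  rw [vNeg, if_neg (by rwa [prob_lev_eq_one_iff])]
  refine le_sInf ?_
  rintro _ ⟨X, ⟨hXm, hX0, -, hXi, hXk, hXc⟩, rfl⟩
  rcases hx.eq_or_lt with hx | hx
  · have h1 := hb c le_rfl hc
    rw [hx, sub_self, zero_div, S.um_zero, zero_mul] at h1
    rw [le_antisymm h1 hm]
    exact EReal.coe_ennreal_nonneg _
  have hk : 0 < xp - S.x0 := by linarith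
  have key : ENNReal.ofReal m ≤ Vmn S X := by
    refine S.ofReal_le_Vmn hXm hX0 hXi hk hXk hm fun x hx0 hpos => ?_
    have hA : NullMeasurableSet {ω | x < X ω} S.P :=
      nullMeasurableSet_lt aemeasurable_const hXm
    have hp : 0 < (S.P {ω | x < X ω}).toReal := by
      refine ENNReal.toReal_pos (fun h => ?_) (measure_ne_top _ _)
      rw [S.priced_ac h] at hpos
      simp at hpos
    have hpc : (S.P {ω | x < X ω}).toReal ≤ (S.P {ω | c < S.ρ ω}).toReal := by
      refine ENNReal.toReal_mono (measure_ne_top _ _) (measure_mono_ae ?_)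
      filter_upwards [hXc] with ω hω (hlt : x < X ω)
      rw [← compl_lev_coe] at *
      intro hmem
      rw [hω hmem] at hlt
      exact hx0.not_gt hlt
    obtain ⟨d, hcd, hd⟩ := S.exists_prob_rho_gt_eq hp hpc
    have hd0 : S.P {ω | d < S.ρ ω} ≠ 0 := fun h => by simp [← hd, h] at hp
    refine (hb d hcd hd0).trans ?_
    rw [one_sub_FdistE_coe, hd]
    refine mul_le_mul_of_nonneg_right ?_ (S.Tm_nonneg (S.prob_mem_Icc _))
    have hE := S.ERhoGt_pos hd0
    exact S.um_mono.monotoneOn (mem_Ici.2 (by positivity)) (mem_Ici.2 (by positivity))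
      (div_le_div_of_nonneg_left hk.le hpos (S.priced_le_ERhoGt hA hd))
  rw [← EReal.coe_ennreal_le_coe_ennreal_iff, EReal.coe_ennreal_ofReal, max_eq_left hm] at key
  exact key

lemma lev_mono (S : BSetup Ω) {c d : EReal} (h : c ≤ d) : lev S c ⊆ lev S d :=
  fun _ hω => le_trans hω h

lemma prob_lev_rhoBar (S : BSetup Ω) : S.P (lev S (rhoBar S)) = 1 := by
  have := S.isProb
  have h : ∀ᵐ ω ∂S.P, (S.ρ ω : EReal) ≤ rhoBar S := ae_le_essSup
  exact (mem_ae_iff_prob_eq_one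
    (measurableSet_le S.meas_ρ.coe_real_ereal measurable_const)).1 h

lemma rhoLow_nonneg (S : BSetup Ω) : 0 ≤ rhoLow S :=
  le_essInf_of_ae_le _ (S.ρ_pos.mono fun _ h => EReal.coe_nonneg.2 h.le)

lemma lt_rhoBar_iff (S : BSetup Ω) (d : ℝ) :
    (d : EReal) < rhoBar S ↔ S.P {ω | d < S.ρ ω} ≠ 0 := by
  rw [← not_le, not_iff_not]
  constructor
  · intro h
    have h1 : ∀ᵐ ω ∂S.P, (S.ρ ω : EReal) ≤ rhoBar S := ae_le_essSup
    refine measure_mono_null (fun ω (hω : d < S.ρ ω) => ?_) (ae_iff.1 h1)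
    exact not_le.2 (h.trans_lt (EReal.coe_lt_coe_iff.2 hω))
  · intro h
    refine essSup_le_of_ae_le _ (ae_iff.2 ?_)
    simpa using h

lemma eq_rhoLow_of_prob_lev_eq_zero (S : BSetup Ω) {c : EReal} (hc : rhoLow S ≤ c)
    (h0 : S.P (lev S c) = 0) : c = rhoLow S := by
  refine le_antisymm (le_essInf_of_ae_le _ ?_) hc
  have : ∀ᵐ ω ∂S.P, ω ∉ lev S c := measure_eq_zero_iff_ae_notMem.1 h0
  exact this.mono fun ω hω => (not_le.1 hω).le

lemma vPos_lev_mono (S : BSetup Ω) {c d : EReal} (hcd : c ≤ d) {xp : ℝ}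
    (h0 : S.P (lev S c) = 0 → xp = 0) : vPos S (lev S c) xp ≤ vPos S (lev S d) xp := by
  by_cases hc : S.P (lev S c) = 0
  · obtain rfl := h0 hc
    rw [vPos, if_pos hc, if_pos rfl, vPos]
    by_cases hd : S.P (lev S d) = 0
    · rw [if_pos hd, if_pos rfl]
    · rw [if_neg hd]
      have hf : FeasPos S (lev S d) 0 fun _ => 0 :=
        ⟨aemeasurable_const, by simp, by simp, by simp, by simp⟩
      have hle : (Vpl S fun _ => 0).toEReal
          ≤ sSup {v : EReal | ∃ X : Ω → ℝ, FeasPos S (lev S d) 0 X ∧ v = (Vpl S X).toEReal} :=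
        le_sSup (by exact ⟨_, hf, rfl⟩)
      exact (EReal.coe_ennreal_nonneg _).trans hle
  · have hd : S.P (lev S d) ≠ 0 := fun h => hc (measure_mono_null (S.lev_mono hcd) h)
    rw [vPos, if_neg hc, vPos, if_neg hd]
    refine sSup_le_sSup ?_
    rintro _ ⟨X, ⟨h1, h2, h3, h4, h5⟩, rfl⟩
    exact ⟨X, ⟨h1, h2, h3, h4, h5.mono fun ω h hω => h fun hc => hω (S.lev_mono hcd hc)⟩, rfl⟩

lemma exists_real_of_feasSc (S : BSetup Ω) {c : EReal} {xp : ℝ} (h : FeasSc S c xp)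
    (hc : c ≠ rhoBar S) : ∃ r : ℝ, c = r ∧ S.P {ω | r < S.ρ ω} ≠ 0 := by
  have hlt := lt_of_le_of_ne h.2.1 hc
  lift c to ℝ using ⟨hlt.ne_top, (lt_of_lt_of_le EReal.bot_lt_zero
    (S.rhoLow_nonneg.trans h.1)).ne'⟩
  exact ⟨c, rfl, (S.lt_rhoBar_iff c).1 hlt⟩

lemma objM_eq_objSc_rhoBar (S : BSetup Ω) :
    objM S (rhoBar S) S.x0 = objSc S (rhoBar S) S.x0 := by
  simp [objM, objSc, vNeg, S.prob_lev_rhoBar, S.um_zero]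

end BSetup

lemma EReal.sub_le_of_forall_le {a b v : EReal} {ι : Type*} {g : ι → ℝ} (i : ι)
    (hg : ∀ i, 0 ≤ g i) (hab : ∀ i, a - g i ≤ b)
    (hv : ∀ m : ℝ, 0 ≤ m → (∀ i, m ≤ g i) → (m : EReal) ≤ v) : a - v ≤ b := by
  induction a with
  | bot => simp
  | top =>
    have := hab i
    rw [EReal.top_sub_coe, top_le_iff] at this
    simp [this]
  | coe a =>
    induction b with
    | bot =>
      have := hab i
      rw [← EReal.coe_sub, le_bot_iff] at this
      exact absurd this (EReal.coe_ne_bot _)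
    | top => exact le_top
    | coe b =>
      have h1 : ((max (a - b) 0 : ℝ) : EReal) ≤ v := by
        refine hv _ (le_max_right _ _) fun i => max_le ?_ (hg i)
        have := hab i
        rw [← EReal.coe_sub, EReal.coe_le_coe_iff] at this
        linarith
      refine (EReal.sub_le_sub le_rfl h1).trans ?_
      rw [← EReal.coe_sub, EReal.coe_le_coe_iff]
      linarith [le_max_left (a - b) 0]

/-- Proposition 8.2: Problems (S_c) and (M) have the same
supremum value. -/
theorem supSc_eq_supM (S : BSetup Ω) (hfin : FinCond S) :
    supSc S = supM S := by
  have := S.isProb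
  refine le_antisymm (sSup_le ?_) (sSup_le ?_)
  · rintro _ ⟨c, xp, hf, rfl⟩
    by_cases hc : c = rhoBar S
    · have hx := hf.2.2.2.2 hc
      refine le_sSup ⟨c, xp, hf, ?_⟩
      rw [hc, hx, S.objM_eq_objSc_rhoBar]
    obtain ⟨r, rfl, hr⟩ := S.exists_real_of_feasSc hf hc
    obtain ⟨hlow, -, hx, hlow0, -⟩ := hf
    have hx0 : S.x0 ≤ xp := (le_max_left _ _).trans hx
    have hterm : ∀ d : ℝ, S.P {ω | d < S.ρ ω} ≠ 0 →
        0 ≤ S.um ((xp - S.x0) / ERhoGt S d) * S.Tm (1 - FdistE S d) := by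
      intro d hd
      rw [S.one_sub_FdistE_coe]
      exact mul_nonneg (S.um_nonneg (div_nonneg (by linarith) (S.ERhoGt_pos hd).le))
        (S.Tm_nonneg (S.prob_mem_Icc _))
    refine EReal.sub_le_of_forall_le (ι := {d : ℝ // r ≤ d ∧ S.P {ω | d < S.ρ ω} ≠ 0})
      (g := fun d => S.um ((xp - S.x0) / ERhoGt S (d : ℝ)) * S.Tm (1 - FdistE S (d : ℝ)))
      ⟨r, le_rfl, hr⟩ (fun d => hterm d d.2.2) ?_ ?_
    · rintro ⟨d, hrd, hd⟩
      have hrd' : (r : EReal) ≤ d := EReal.coe_le_coe_iff.2 hrd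
      have hdlt := (S.lt_rhoBar_iff d).2 hd
      refine (EReal.sub_le_sub (S.vPos_lev_mono hrd' fun h0 =>
        hlow0 (S.eq_rhoLow_of_prob_lev_eq_zero hlow h0)) le_rfl).trans
        (le_sSup ⟨d, xp, ⟨hlow.trans hrd', hdlt.le, hx, fun h => ?_, fun h => ?_⟩, rfl⟩)
      · exact hlow0 (le_antisymm (hrd'.trans h.le) hlow)
      · exact absurd h hdlt.ne
    · exact fun m hm hmg => S.le_vNeg_lev hx0 hr hm fun d h1 h2 => hmg ⟨d, h1, h2⟩
  · rintro _ ⟨c, xp, hf, rfl⟩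
    by_cases hc : c = rhoBar S
    · have hx := hf.2.2.2.2 hc
      refine le_sSup ⟨c, xp, hf, ?_⟩
      rw [hc, hx, S.objM_eq_objSc_rhoBar]
    refine le_trans ?_ (le_sSup ⟨c, xp, hf, rfl⟩)
    obtain ⟨r, rfl, hr⟩ := S.exists_real_of_feasSc hf hc
    exact EReal.sub_le_sub le_rfl (S.vNeg_lev_le ((le_max_left _ _).trans hf.2.2.1) hr)

end
end

section
/- Let Y be a random variable with Y > 0 a.s. that is atomless (P{Y = a} = 0 for all a ∈ ℝ), with distribution function F, and let G be the distribution function of a nonnegative random variable (nondecreasing, right-continuous, G(x) = 0 for x < 0, G(+∞) = 1), with G⁻¹(x) := inf{y ≥ 0 : G(y) ≥ x}. (i) X₁* := G⁻¹(F(Y)) has distribution function G and satisfies E[X₁*·Y] ≥ E[X·Y] for every random variable X with distribution function G; if moreover E[X₁*·Y] < ∞, then X₁* is the unique (up to a.s. equality) maximizer of E[X·Y] over all X with distribution function G. (ii) X₂* := G⁻¹(1 − F(Y)) has distribution function G and satisfies E[X₂*·Y] ≤ E[X·Y] for every random variable X with distribution function G; if moreover E[X₂*·Y] < ∞, then X₂*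 is the unique (up to a.s. equality) minimizer. -/
open MeasureTheory Set Filter
open scoped ENNReal

noncomputable section

section Bathtub

variable {Ω : Type*} [MeasurableSpace Ω] {P : Measure Ω} {Y : Ω → ℝ}

/-- The comparison of two events underlying the bathtub principle: among events of equal
probability, the integral of `Y` is largest on a superlevel set of `Y`. -/
def LevelDominated (P : Measure Ω) (Y : Ω → ℝ) (A B : Set Ω) : Prop :=
  P.withDensity (fun ω => ENNReal.ofReal (Y ω)) A ≤
      P.withDensity (fun ω => ENNReal.ofReal (Y ω)) B ∧
    (P.withDensity (fun ω => ENNReal.ofReal (Y ω)) A =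
        P.withDensity (fun ω => ENNReal.ofReal (Y ω)) B →
      P.withDensity (fun ω => ENNReal.ofReal (Y ω)) A ≠ ∞ → A =ᵐ[P] B)

lemma LevelDominated.of_ae_eq {A B : Set Ω} (h : A =ᵐ[P] B) : LevelDominated P Y A B :=
  ⟨(measure_congr ((withDensity_absolutelyContinuous P _).ae_le h)).le, fun _ _ => h⟩

/-- The bathtub principle. -/
lemma LevelDominated.of_threshold [IsFiniteMeasure P] (hY : Measurable Y)
    (hYpos : ∀ᵐ ω ∂P, 0 < Y ω) {A B : Set Ω} (hA : MeasurableSet A) (hB : MeasurableSet B)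
    (hAB : P A = P B) (c : ℝ) (hle : ∀ᵐ ω ∂P, ω ∈ A \ B → Y ω ≤ c)
    (hlt : ∀ᵐ ω ∂P, ω ∈ B \ A → c < Y ω) : LevelDominated P Y A B := by
  have hdiff : P (A \ B) = P (B \ A) := by
    have h1 := measure_inter_add_sdiff (μ := P) A hB
    have h2 := measure_inter_add_sdiff (μ := P) B hA
    rw [inter_comm] at h2
    refine (ENNReal.add_right_inj (measure_ne_top P (A ∩ B))).1 ?_
    rw [h1, h2, hAB]
  set ν := P.withDensity (fun ω => ENNReal.ofReal (Y ω)) with hν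
  have hνA : ν (A ∩ B) + ν (A \ B) = ν A := measure_inter_add_sdiff A hB
  have hνB : ν (A ∩ B) + ν (B \ A) = ν B := by
    rw [inter_comm]; exact measure_inter_add_sdiff B hA
  have hupper : ν (A \ B) ≤ ENNReal.ofReal c * P (A \ B) := by
    rw [hν, withDensity_apply _ (hA.diff hB), ← setLIntegral_const]
    refine lintegral_mono_ae ((ae_restrict_iff' (hA.diff hB)).2 ?_)
    filter_upwards [hle] with ω h hω using ENNReal.ofReal_le_ofReal (h hω)
  have hlower : ENNReal.ofReal c * P (A \ B) ≤ ν (B \ A) := by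
    rw [hν, withDensity_apply _ (hB.diff hA), hdiff, ← setLIntegral_const]
    refine lintegral_mono_ae ((ae_restrict_iff' (hB.diff hA)).2 ?_)
    filter_upwards [hlt] with ω h hω using ENNReal.ofReal_le_ofReal (h hω).le
  refine ⟨?_, fun heq hfin => ?_⟩
  · rw [← hνA, ← hνB]
    exact add_le_add le_rfl (hupper.trans hlower)
  · change ν A = ν B at heq
    change ν A ≠ ∞ at hfin
    have hfin' : ν (A ∩ B) ≠ ∞ := ne_top_of_le_ne_top hfin (measure_mono inter_subset_left)
    have heq' : ν (A \ B) = ν (B \ A) := by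
      rwa [← hνA, ← hνB, ENNReal.add_right_inj hfin'] at heq
    have hzero : P (B \ A) = 0 := by
      by_contra hne
      have := setLIntegral_strict_mono (μ := P) (f := fun _ => ENNReal.ofReal c)
        (g := fun ω => ENNReal.ofReal (Y ω)) (hB.diff hA) hne hY.ennreal_ofReal
        (by rw [setLIntegral_const]; exact ENNReal.mul_ne_top ENNReal.ofReal_ne_top
              (measure_ne_top _ _))
        (by
          filter_upwards [hlt, hYpos] with ω h hp hω
          exact (ENNReal.ofReal_lt_ofReal_iff hp).2 (h hω))
      rw [setLIntegral_const, ← withDensity_apply _ (hB.diff hA), ← hν, ← heq', ← hdiff] at this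
      exact absurd hupper (not_le.2 this)
    exact (ae_le_set.2 (hdiff.trans hzero)).antisymm (ae_le_set.2 hzero)

lemma lintegral_ofReal_mul_eq_lintegral_meas_lt (hY : Measurable Y) (hYpos : ∀ᵐ ω ∂P, 0 < Y ω)
    {X : Ω → ℝ} (hX : Measurable X) (hX0 : ∀ᵐ ω ∂P, 0 ≤ X ω) :
    ∫⁻ ω, ENNReal.ofReal (X ω * Y ω) ∂P =
      ∫⁻ t in Ioi (0 : ℝ), P.withDensity (fun ω => ENNReal.ofReal (Y ω)) {ω | t < X ω} := by
  rw [← lintegral_eq_lintegral_meas_lt _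
      ((withDensity_absolutelyContinuous P _).ae_le hX0) hX.aemeasurable,
    lintegral_withDensity_eq_lintegral_mul _ hY.ennreal_ofReal hX.ennreal_ofReal]
  refine lintegral_congr_ae ?_
  filter_upwards [hYpos] with ω h
  rw [Pi.mul_apply, ENNReal.ofReal_mul' h.le, mul_comm]

lemma lintegral_ofReal_mul_le_of_levelDominated (hY : Measurable Y)
    (hYpos : ∀ᵐ ω ∂P, 0 < Y ω) {X Z : Ω → ℝ} (hX : Measurable X) (hZ : Measurable Z)
    (hX0 : ∀ᵐ ω ∂P, 0 ≤ X ω) (hZ0 : ∀ᵐ ω ∂P, 0 ≤ Z ω)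
    (h : ∀ t > 0, LevelDominated P Y {ω | t < X ω} {ω | t < Z ω}) :
    ∫⁻ ω, ENNReal.ofReal (X ω * Y ω) ∂P ≤ ∫⁻ ω, ENNReal.ofReal (Z ω * Y ω) ∂P := by
  rw [lintegral_ofReal_mul_eq_lintegral_meas_lt hY hYpos hX hX0,
    lintegral_ofReal_mul_eq_lintegral_meas_lt hY hYpos hZ hZ0]
  exact setLIntegral_mono' measurableSet_Ioi fun t ht => (h t ht).1

lemma ae_eq_of_dense_ae_eq_setOf_lt {X Z : Ω → ℝ} (hX0 : ∀ᵐ ω ∂P, 0 ≤ X ω)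
    (hZ0 : ∀ᵐ ω ∂P, 0 ≤ Z ω) {T : Set ℝ} (hT : Dense T)
    (h : ∀ t ∈ T, 0 < t → {ω | t < X ω} =ᵐ[P] {ω | t < Z ω}) : X =ᵐ[P] Z := by
  obtain ⟨D, hDT, hDc, hD⟩ := hT.exists_countable_dense_subset
  have hall : ∀ᵐ ω ∂P, ∀ t ∈ D, 0 < t → (t < X ω ↔ t < Z ω) := by
    rw [ae_ball_iff hDc]
    intro t ht
    by_cases h0 : 0 < t
    · filter_upwards [h t (hDT ht) h0] with ω hω _
      exact iff_of_eq hω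
    · exact Eventually.of_forall fun _ h' => absurd h' h0
  filter_upwards [hall, hX0, hZ0] with ω hω hx hz
  rcases lt_trichotomy (X ω) (Z ω) with hlt | heq | hlt
  · obtain ⟨t, htD, h1, h2⟩ := hD.exists_between hlt
    exact absurd ((hω t htD (hx.trans_lt h1)).2 h2) h1.not_gt
  · exact heq
  · obtain ⟨t, htD, h1, h2⟩ := hD.exists_between hlt
    exact absurd ((hω t htD (hz.trans_lt h1)).1 h2) h1.not_gt

lemma ae_eq_of_levelDominated (hY : Measurable Y)
    (hYpos : ∀ᵐ ω ∂P, 0 < Y ω) {X Z : Ω → ℝ} (hX : Measurable X) (hZ : Measurable Z)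
    (hX0 : ∀ᵐ ω ∂P, 0 ≤ X ω) (hZ0 : ∀ᵐ ω ∂P, 0 ≤ Z ω)
    (h : ∀ t > 0, LevelDominated P Y {ω | t < X ω} {ω | t < Z ω})
    (hle : ∫⁻ ω, ENNReal.ofReal (Z ω * Y ω) ∂P ≤ ∫⁻ ω, ENNReal.ofReal (X ω * Y ω) ∂P)
    (hfin : ∫⁻ ω, ENNReal.ofReal (X ω * Y ω) ∂P ≠ ∞) : X =ᵐ[P] Z := by
  rw [lintegral_ofReal_mul_eq_lintegral_meas_lt hY hYpos hX hX0] at hle hfin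
  rw [lintegral_ofReal_mul_eq_lintegral_meas_lt hY hYpos hZ hZ0] at hle
  have hmeas (W : Ω → ℝ) : Measurable fun t : ℝ =>
      P.withDensity (fun ω => ENNReal.ofReal (Y ω)) {ω | t < W ω} :=
    Antitone.measurable fun s t hst => measure_mono fun ω hω => lt_of_le_of_lt hst hω
  have hae := ae_eq_of_ae_le_of_lintegral_le
    ((ae_restrict_iff' measurableSet_Ioi).2 (Eventually.of_forall fun t ht => (h t ht).1))
    hfin (hmeas Z).aemeasurable hle
  have hfin' := ae_lt_top (hmeas X) hfin
  have hT : ∀ᵐ t : ℝ, 0 < t → {ω | t < X ω} =ᵐ[P] {ω | t < Z ω} := by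
    filter_upwards [(ae_restrict_iff' measurableSet_Ioi).1 hae,
      (ae_restrict_iff' measurableSet_Ioi).1 hfin'] with t h1 h2 ht
    exact (h t ht).2 (h1 ht) (h2 ht).ne
  exact ae_eq_of_dense_ae_eq_setOf_lt hX0 hZ0 (Measure.dense_of_ae hT) fun t ht => ht

end Bathtub

section Quantile

lemma continuous_of_atomless {Ω : Type*} [MeasurableSpace Ω] {P : Measure Ω}
    [IsProbabilityMeasure P] {Y : Ω → ℝ} (hY : Measurable Y)
    (hYatomless : ∀ a : ℝ, P {ω | Y ω = a} = 0) {F : ℝ → ℝ}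
    (hF : ∀ x : ℝ, F x = (P {ω | Y ω ≤ x}).toReal) :
    Monotone F ∧ Continuous F ∧ Tendsto F atTop (nhds 1) := by
  have := Measure.isProbabilityMeasure_map (μ := P) hY.aemeasurable
  have hcdf : F = ProbabilityTheory.cdf (P.map Y) := by
    ext x
    rw [hF, ProbabilityTheory.cdf_eq_real, measureReal_def,
      Measure.map_apply hY measurableSet_Iic]
    rfl
  rw [hcdf]
  refine ⟨ProbabilityTheory.monotone_cdf _, continuous_iff_continuousAt.2 fun x => ?_,
    ProbabilityTheory.tendsto_cdf_atTop _⟩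
  rw [(ProbabilityTheory.monotone_cdf _).continuousAt_iff_leftLim_eq_rightLim,
    StieltjesFunction.rightLim_eq]
  have h := (ProbabilityTheory.cdf (P.map Y)).measure_singleton x
  rw [ProbabilityTheory.measure_cdf, Measure.map_apply hY (measurableSet_singleton x)] at h
  have h0 : P (Y ⁻¹' {x}) = 0 := hYatomless x
  rw [h0, eq_comm, ENNReal.ofReal_eq_zero] at h
  exact le_antisymm ((ProbabilityTheory.monotone_cdf _).leftLim_le le_rfl) (by linarith)

variable {F : ℝ → ℝ}

lemma exists_threshold_le (hmono : Monotone F) (hcont : Continuous F)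
    (htop : Tendsto F atTop (nhds 1)) {a g : ℝ} (ha : F a ≤ g) (hg : g < 1) :
    ∃ c, F c = g ∧ ∀ y, F y ≤ g ↔ y ≤ c := by
  obtain ⟨b, hb⟩ := (htop.eventually (lt_mem_nhds hg)).exists
  obtain ⟨y₀, hy₀⟩ := mem_range_of_exists_le_of_exists_ge hcont ⟨a, ha⟩ ⟨b, hb.le⟩
  have hbdd : BddAbove {y | F y ≤ g} :=
    ⟨b, fun y hy => le_of_lt (hmono.reflect_lt (lt_of_le_of_lt hy hb))⟩
  have hmem : sSup {y | F y ≤ g} ∈ {y | F y ≤ g} :=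
    (isClosed_le hcont continuous_const).csSup_mem ⟨a, ha⟩ hbdd
  refine ⟨_, le_antisymm hmem ?_, fun y => ⟨fun hy => le_csSup hbdd hy,
    fun hy => (hmono hy).trans hmem⟩⟩
  exact hy₀.ge.trans (hmono (le_csSup hbdd hy₀.le))

lemma exists_threshold_lt (hmono : Monotone F) (hcont : Continuous F)
    (htop : Tendsto F atTop (nhds 1)) {a g : ℝ} (ha : F a < g) (hg : g < 1) :
    ∃ c, F c = g ∧ ∀ y, F y < g ↔ y < c := by
  obtain ⟨b, hb⟩ := (htop.eventually (lt_mem_nhds hg)).exists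
  obtain ⟨y₀, hy₀⟩ := mem_range_of_exists_le_of_exists_ge hcont ⟨a, ha.le⟩ ⟨b, hb.le⟩
  have hbdd : BddBelow {y | g ≤ F y} :=
    ⟨a, fun y hy => le_of_lt (hmono.reflect_lt (lt_of_lt_of_le ha hy))⟩
  have hmem : sInf {y | g ≤ F y} ∈ {y | g ≤ F y} :=
    (isClosed_le continuous_const hcont).csInf_mem ⟨b, hb.le⟩ hbdd
  refine ⟨_, le_antisymm ?_ hmem, fun y => ?_⟩
  · exact (hmono (csInf_le hbdd hy₀.ge)).trans hy₀.le
  · rw [← not_le, ← not_le, not_iff_not]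
    exact ⟨fun hy => csInf_le hbdd hy, fun hy => le_trans hmem (hmono hy)⟩

variable {G Ginv : ℝ → ℝ}

/-- The Galois connection between `G` and its generalized inverse. -/
lemma generalizedInverse_le_iff (hGmono : Monotone G)
    (hGrc : ∀ x : ℝ, ContinuousWithinAt G (Ici x) x) (hGneg : ∀ x : ℝ, x < 0 → G x = 0)
    (hGtop : Tendsto G atTop (nhds 1))
    (hGinv : ∀ x : ℝ, Ginv x = sInf {y : ℝ | 0 ≤ y ∧ x ≤ G y}) {u : ℝ} (hu : u ∈ Ioo 0 1)
    (x : ℝ) : Ginv u ≤ x ↔ u ≤ G x := by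
  have hbdd : BddBelow {y : ℝ | 0 ≤ y ∧ u ≤ G y} := ⟨0, fun y hy => hy.1⟩
  rw [hGinv]
  constructor
  · intro h
    have hne : {y : ℝ | 0 ≤ y ∧ u ≤ G y}.Nonempty := by
      obtain ⟨b, hb, hb0⟩ :=
        ((hGtop.eventually (lt_mem_nhds hu.2)).and (eventually_ge_atTop 0)).exists
      exact ⟨b, hb0, hb.le⟩
    refine ge_of_tendsto ((hGrc x).mono Ioi_subset_Ici_self) ?_
    filter_upwards [self_mem_nhdsWithin] with z hz
    obtain ⟨y, hy, hyz⟩ := exists_lt_of_csInf_lt hne (lt_of_le_of_lt h hz)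
    exact hy.2.trans (hGmono hyz.le)
  · intro h
    have hx : 0 ≤ x := by
      by_contra hx
      rw [hGneg x (not_le.1 hx)] at h
      exact absurd hu.1 (not_lt.2 h)
    exact csInf_le hbdd ⟨hx, h⟩

lemma measurable_indicator_generalizedInverse (hGmono : Monotone G)
    (hGrc : ∀ x : ℝ, ContinuousWithinAt G (Ici x) x) (hGneg : ∀ x : ℝ, x < 0 → G x = 0)
    (hGtop : Tendsto G atTop (nhds 1))
    (hGinv : ∀ x : ℝ, Ginv x = sInf {y : ℝ | 0 ≤ y ∧ x ≤ G y}) :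
    Measurable ((Ioo (0 : ℝ) 1).indicator Ginv) := by
  have hle := @generalizedInverse_le_iff G Ginv hGmono hGrc hGneg hGtop hGinv
  refine measurable_of_restrict_of_restrict_compl (s := Ioo (0 : ℝ) 1) measurableSet_Ioo ?_ ?_
  · refine Monotone.measurable fun u v huv => ?_
    rw [domRestrict_apply, domRestrict_apply, indicator_of_mem u.2, indicator_of_mem v.2, hle u.2]
    exact le_trans (Subtype.coe_le_coe.2 huv) ((hle v.2 _).1 le_rfl)
  · convert measurable_const (a := (0 : ℝ)) using 1
    ext u
    exact indicator_of_notMem u.2 _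

end Quantile

section ProbabilityTransform

variable {Ω : Type*} [MeasurableSpace Ω] {P : Measure Ω}
  {Y : Ω → ℝ} {F G Ginv : ℝ → ℝ}

/-- A quantile transform of a uniform variable has a measurable version with law `G`. -/
lemma exists_measurable_quantile (hGmono : Monotone G)
    (hGrc : ∀ x : ℝ, ContinuousWithinAt G (Ici x) x) (hGneg : ∀ x : ℝ, x < 0 → G x = 0)
    (hGtop : Tendsto G atTop (nhds 1))
    (hGinv : ∀ x : ℝ, Ginv x = sInf {y : ℝ | 0 ≤ y ∧ x ≤ G y})
    {U : Ω → ℝ} (hU : Measurable U) (hU01 : ∀ᵐ ω ∂P, U ω ∈ Ioo 0 1)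
    (hunif : ∀ g ∈ Icc (0 : ℝ) 1, (P {ω | U ω ≤ g}).toReal = g) :
    ∃ Z : Ω → ℝ, Measurable Z ∧ Z =ᵐ[P] (fun ω => Ginv (U ω)) ∧
      (∀ x, {ω | x < Z ω} =ᵐ[P] {ω | G x < U ω}) ∧
      (∀ x, (P {ω | Z ω ≤ x}).toReal = G x) := by
  have hG01 (x : ℝ) : G x ∈ Icc 0 1 := by
    refine ⟨?_, hGmono.ge_of_tendsto hGtop x⟩
    rw [← hGneg (min x 0 - 1) (by linarith [min_le_right x 0])]
    exact hGmono (by linarith [min_le_left x 0])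
  have hZ : (fun ω => (Ioo (0 : ℝ) 1).indicator Ginv (U ω)) =ᵐ[P] (fun ω => Ginv (U ω)) := by
    filter_upwards [hU01] with ω hω using indicator_of_mem hω _
  have hiff : ∀ᵐ ω ∂P, ∀ x, (Ioo (0 : ℝ) 1).indicator Ginv (U ω) ≤ x ↔ U ω ≤ G x := by
    filter_upwards [hU01] with ω hω x
    rw [indicator_of_mem hω]
    exact generalizedInverse_le_iff hGmono hGrc hGneg hGtop hGinv hω x
  refine ⟨_, (measurable_indicator_generalizedInverse hGmono hGrc hGneg hGtop hGinv).comp hU,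
    hZ, fun x => ?_, fun x => ?_⟩
  · filter_upwards [hiff] with ω hω
    exact propext (not_le.symm.trans ((not_congr (hω x)).trans not_le))
  · rw [← hunif _ (hG01 x)]
    congr 1
    refine measure_congr ?_
    filter_upwards [hiff] with ω hω
    exact propext (hω x)

variable [IsProbabilityMeasure P]

lemma measure_distribution_le (hYpos : ∀ᵐ ω ∂P, 0 < Y ω)
    (hF : ∀ x : ℝ, F x = (P {ω | Y ω ≤ x}).toReal) (hmono : Monotone F) (hcont : Continuous F)
    (htop : Tendsto F atTop (nhds 1)) {g : ℝ} (hg : g ∈ Icc 0 1) :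
    (P {ω | F (Y ω) ≤ g}).toReal = g := by
  have hF0 : F 0 = 0 := by
    have : P {ω | Y ω ≤ 0} = 0 := by simpa [ae_iff] using hYpos
    rw [hF, this, ENNReal.toReal_zero]
  rcases hg.2.lt_or_eq with h1 | rfl
  · obtain ⟨c, hc, hiff⟩ := exists_threshold_le hmono hcont htop (hF0.trans_le hg.1) h1
    simp_rw [hiff, ← hF, hc]
  · have (ω : Ω) : F (Y ω) ≤ 1 := hmono.ge_of_tendsto htop _
    simp [this]

lemma measure_distribution_lt (hYpos : ∀ᵐ ω ∂P, 0 < Y ω)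
    (hYatomless : ∀ a : ℝ, P {ω | Y ω = a} = 0)
    (hF : ∀ x : ℝ, F x = (P {ω | Y ω ≤ x}).toReal) (hmono : Monotone F) (hcont : Continuous F)
    (htop : Tendsto F atTop (nhds 1)) {g : ℝ} (hg : g ∈ Icc 0 1) :
    (P {ω | F (Y ω) < g}).toReal = g := by
  have hF0 : F 0 = 0 := by
    have : P {ω | Y ω ≤ 0} = 0 := by simpa [ae_iff] using hYpos
    rw [hF, this, ENNReal.toReal_zero]
  have hlt {g : ℝ} (h0 : 0 < g) (h1 : g < 1) : (P {ω | F (Y ω) < g}).toReal = g := by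
    obtain ⟨c, hc, hiff⟩ := exists_threshold_lt hmono hcont htop (hF0.trans_lt h0) h1
    have hae : {ω | Y ω < c} =ᵐ[P] {ω | Y ω ≤ c} := by
      have : ∀ᵐ ω ∂P, Y ω ≠ c := by simpa [ae_iff] using hYatomless c
      filter_upwards [this] with ω hω
      exact propext ⟨le_of_lt, fun h => lt_of_le_of_ne h hω⟩
    simp_rw [hiff]
    rw [measure_congr hae, ← hF, hc]
  rcases hg.1.eq_or_lt with rfl | h0
  · have (ω : Ω) : 0 ≤ F (Y ω) := by rw [hF]; exact ENNReal.toReal_nonneg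
    simp [fun ω => not_lt.2 (this ω)]
  rcases hg.2.lt_or_eq with h1 | rfl
  · exact hlt h0 h1
  · refine le_antisymm measureReal_le_one (le_of_forall_lt_imp_le_of_dense fun g hg' => ?_)
    rcases le_or_gt g 0 with hg0 | hg0
    · exact hg0.trans ENNReal.toReal_nonneg
    · rw [← hlt hg0 hg']
      exact measureReal_mono fun ω (hω : F (Y ω) < g) => hω.trans hg'

lemma ae_distribution_mem_Ioo (hY : Measurable Y) (hYpos : ∀ᵐ ω ∂P, 0 < Y ω)
    (hYatomless : ∀ a : ℝ, P {ω | Y ω = a} = 0)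
    (hF : ∀ x : ℝ, F x = (P {ω | Y ω ≤ x}).toReal) (hmono : Monotone F) (hcont : Continuous F)
    (htop : Tendsto F atTop (nhds 1)) : ∀ᵐ ω ∂P, F (Y ω) ∈ Ioo 0 1 := by
  have h0 := measure_distribution_le hYpos hF hmono hcont htop (g := 0) (by simp)
  have h1 := measure_distribution_lt hYpos hYatomless hF hmono hcont htop (g := 1) (by simp)
  have h0' : ∀ᵐ ω ∂P, 0 < F (Y ω) := by
    rw [ENNReal.toReal_eq_zero_iff] at h0
    simpa [ae_iff, measure_ne_top] using h0
  have h1' : ∀ᵐ ω ∂P, F (Y ω) < 1 := by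
    rw [ae_iff]
    refine (prob_compl_eq_zero_iff
      (measurableSet_lt (hcont.measurable.comp hY) measurable_const)).2 ?_
    exact (ENNReal.toReal_eq_one_iff _).1 h1
  filter_upwards [h0', h1'] with ω a b using ⟨a, b⟩

lemma ae_nonneg_of_distribution (hGneg : ∀ x : ℝ, x < 0 → G x = 0) {X : Ω → ℝ}
    (hXG : ∀ x : ℝ, (P {ω | X ω ≤ x}).toReal = G x) : ∀ᵐ ω ∂P, 0 ≤ X ω := by
  have h (n : ℕ) : ∀ᵐ ω ∂P, -(1 / ((n : ℝ) + 1)) < X ω := by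
    have := hXG (-(1 / ((n : ℝ) + 1)))
    rw [hGneg _ (by simp only [Left.neg_neg_iff]; positivity),
      ENNReal.toReal_eq_zero_iff] at this
    simpa [ae_iff, measure_ne_top] using this
  filter_upwards [ae_all_iff.2 h] with ω hω
  by_contra hneg
  obtain ⟨n, hn⟩ := exists_nat_one_div_lt (neg_pos.2 (not_le.1 hneg))
  linarith [hω n]

lemma measure_setOf_lt_of_distribution {X : Ω → ℝ} (hX : Measurable X)
    (hXG : ∀ x : ℝ, (P {ω | X ω ≤ x}).toReal = G x) (x : ℝ) :
    P {ω | x < X ω} = 1 - ENNReal.ofReal (G x) := by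
  rw [← hXG x, ENNReal.ofReal_toReal (measure_ne_top _ _),
    ← prob_compl_eq_one_sub (measurableSet_le hX measurable_const)]
  congr 1
  ext ω
  simp

end ProbabilityTransform

section Optimizers

variable {Ω : Type*} [MeasurableSpace Ω] {P : Measure Ω} [IsProbabilityMeasure P]
  {Y : Ω → ℝ} {F G : ℝ → ℝ}

lemma levelDominated_comonotone (hY : Measurable Y) (hYpos : ∀ᵐ ω ∂P, 0 < Y ω)
    (hF : ∀ x : ℝ, F x = (P {ω | Y ω ≤ x}).toReal) (hmono : Monotone F) (hcont : Continuous F)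
    (htop : Tendsto F atTop (nhds 1)) {X Z : Ω → ℝ} (hX : Measurable X) (hZ : Measurable Z)
    (hXG : ∀ x : ℝ, (P {ω | X ω ≤ x}).toReal = G x)
    (hZG : ∀ x : ℝ, (P {ω | Z ω ≤ x}).toReal = G x)
    {t : ℝ} (hlevel : {ω | t < Z ω} =ᵐ[P] {ω | G t < F (Y ω)}) :
    LevelDominated P Y {ω | t < X ω} {ω | t < Z ω} := by
  have hXt := measure_setOf_lt_of_distribution hX hXG t
  have hZt := measure_setOf_lt_of_distribution hZ hZG t
  have hG0 : 0 ≤ G t := by rw [← hXG]; exact ENNReal.toReal_nonneg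
  rcases le_or_gt 1 (G t) with h1 | h1
  · have hz : 1 - ENNReal.ofReal (G t) = 0 :=
      tsub_eq_zero_of_le (ENNReal.one_le_ofReal.2 h1)
    exact .of_ae_eq ((ae_eq_empty.2 (hXt.trans hz)).trans (ae_eq_empty.2 (hZt.trans hz)).symm)
  have hF0 : F 0 = 0 := by
    have : P {ω | Y ω ≤ 0} = 0 := by simpa [ae_iff] using hYpos
    rw [hF, this, ENNReal.toReal_zero]
  obtain ⟨c, -, hiff⟩ := exists_threshold_le hmono hcont htop (hF0.trans_le hG0) h1
  refine .of_threshold hY hYpos (measurableSet_lt measurable_const hX)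
    (measurableSet_lt measurable_const hZ) (hXt.trans hZt.symm) c ?_ ?_
  · filter_upwards [hlevel.mem_iff] with ω hω h
    exact (hiff _).1 (not_lt.1 fun h' => h.2 (hω.2 h'))
  · filter_upwards [hlevel.mem_iff] with ω hω h
    exact not_le.1 fun h' => absurd ((hiff _).2 h') (not_le.2 (hω.1 h.1))

lemma levelDominated_antimonotone (hY : Measurable Y) (hYpos : ∀ᵐ ω ∂P, 0 < Y ω)
    (hYatomless : ∀ a : ℝ, P {ω | Y ω = a} = 0)
    (hF : ∀ x : ℝ, F x = (P {ω | Y ω ≤ x}).toReal) (hmono : Monotone F) (hcont : Continuous F)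
    (htop : Tendsto F atTop (nhds 1)) {X Z : Ω → ℝ} (hX : Measurable X) (hZ : Measurable Z)
    (hXG : ∀ x : ℝ, (P {ω | X ω ≤ x}).toReal = G x)
    (hZG : ∀ x : ℝ, (P {ω | Z ω ≤ x}).toReal = G x)
    {t : ℝ} (hlevel : {ω | t < Z ω} =ᵐ[P] {ω | G t < 1 - F (Y ω)}) :
    LevelDominated P Y {ω | t < Z ω} {ω | t < X ω} := by
  have hXt := measure_setOf_lt_of_distribution hX hXG t
  have hZt := measure_setOf_lt_of_distribution hZ hZG t
  have hG0 : 0 ≤ G t := by rw [← hXG]; exact ENNReal.toReal_nonneg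
  have hXm : MeasurableSet {ω | t < X ω} := measurableSet_lt measurable_const hX
  have hZm : MeasurableSet {ω | t < Z ω} := measurableSet_lt measurable_const hZ
  rcases le_or_gt 1 (G t) with h1 | h1
  · have hz : 1 - ENNReal.ofReal (G t) = 0 :=
      tsub_eq_zero_of_le (ENNReal.one_le_ofReal.2 h1)
    exact .of_ae_eq ((ae_eq_empty.2 (hZt.trans hz)).trans (ae_eq_empty.2 (hXt.trans hz)).symm)
  rcases hG0.eq_or_lt with h0 | h0
  · have hz : 1 - ENNReal.ofReal (G t) = 1 := by simp [← h0]
    refine .of_ae_eq ((ae_eq_univ.2 ?_).trans (ae_eq_univ.2 ?_).symm)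
    · rw [prob_compl_eq_zero_iff hZm, hZt, hz]
    · rw [prob_compl_eq_zero_iff hXm, hXt, hz]
  have hF0 : F 0 = 0 := by
    have : P {ω | Y ω ≤ 0} = 0 := by simpa [ae_iff] using hYpos
    rw [hF, this, ENNReal.toReal_zero]
  obtain ⟨c, -, hiff⟩ := exists_threshold_lt hmono hcont htop (a := 0) (g := 1 - G t)
    (by linarith) (by linarith)
  have hc : ∀ᵐ ω ∂P, Y ω ≠ c := by simpa [ae_iff] using hYatomless c
  refine .of_threshold hY hYpos hZm hXm (hZt.trans hXt.symm) c ?_ ?_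
  · filter_upwards [hlevel.mem_iff] with ω hω h
    have : G t < 1 - F (Y ω) := hω.1 h.1
    exact ((hiff _).1 (by linarith)).le
  · filter_upwards [hlevel.mem_iff, hc] with ω hω hne h
    refine lt_of_le_of_ne (not_lt.1 fun h' => h.2 (hω.2 ?_)) hne.symm
    have := (hiff _).2 h'
    change G t < 1 - F (Y ω)
    linarith

end Optimizers

/-- Theorem B.1: for an atomless `Y > 0` with distribution
function `F`, and a distribution function `G` of a nonnegative random variable
with generalized inverse `G⁻¹`:
(i) `X₁* = G⁻¹(F(Y))` has distribution function `G`, maximizes `E[XY]` among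
all `X` with distribution function `G`, and is the unique maximizer if
`E[X₁* Y] < ∞`;
(ii) `X₂* = G⁻¹(1 − F(Y))` has distribution function `G`, minimizes `E[XY]`,
and is the unique minimizer if `E[X₂* Y] < ∞`. -/
theorem comonotone_optimizers
    {Ω : Type*} [MeasurableSpace Ω] (P : MeasureTheory.Measure Ω)
    [MeasureTheory.IsProbabilityMeasure P]
    (Y : Ω → ℝ) (hY : Measurable Y) (hYpos : ∀ᵐ ω ∂P, 0 < Y ω)
    (hYatomless : ∀ a : ℝ, P {ω | Y ω = a} = 0)
    (F : ℝ → ℝ) (hF : ∀ x : ℝ, F x = (P {ω | Y ω ≤ x}).toReal)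
    (G : ℝ → ℝ) (hGmono : Monotone G)
    (hGrc : ∀ x : ℝ, ContinuousWithinAt G (Set.Ici x) x)
    (hGneg : ∀ x : ℝ, x < 0 → G x = 0)
    (hGtop : Filter.Tendsto G Filter.atTop (nhds 1))
    (Ginv : ℝ → ℝ) (hGinv : ∀ x : ℝ, Ginv x = sInf {y : ℝ | 0 ≤ y ∧ x ≤ G y}) :
    -- (i) the maximization problem
    ((∀ x : ℝ, (P {ω | Ginv (F (Y ω)) ≤ x}).toReal = G x) ∧
     (∀ X : Ω → ℝ, Measurable X → (∀ x : ℝ, (P {ω | X ω ≤ x}).toReal = G x) →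
        (∫⁻ ω, ENNReal.ofReal (X ω * Y ω) ∂P) ≤
          (∫⁻ ω, ENNReal.ofReal (Ginv (F (Y ω)) * Y ω) ∂P)) ∧
     ((∫⁻ ω, ENNReal.ofReal (Ginv (F (Y ω)) * Y ω) ∂P) < ⊤ →
       ∀ X : Ω → ℝ, Measurable X → (∀ x : ℝ, (P {ω | X ω ≤ x}).toReal = G x) →
         (∀ X' : Ω → ℝ, Measurable X' → (∀ x : ℝ, (P {ω | X' ω ≤ x}).toReal = G x) →
            (∫⁻ ω, ENNReal.ofReal (X' ω * Y ω) ∂P) ≤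
              (∫⁻ ω, ENNReal.ofReal (X ω * Y ω) ∂P)) →
         X =ᵐ[P] fun ω => Ginv (F (Y ω)))) ∧
    -- (ii) the minimization problem
    ((∀ x : ℝ, (P {ω | Ginv (1 - F (Y ω)) ≤ x}).toReal = G x) ∧
     (∀ X : Ω → ℝ, Measurable X → (∀ x : ℝ, (P {ω | X ω ≤ x}).toReal = G x) →
        (∫⁻ ω, ENNReal.ofReal (Ginv (1 - F (Y ω)) * Y ω) ∂P) ≤
          (∫⁻ ω, ENNReal.ofReal (X ω * Y ω) ∂P)) ∧
     ((∫⁻ ω, ENNReal.ofReal (Ginv (1 - F (Y ω)) * Y ω) ∂P) < ⊤ →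
       ∀ X : Ω → ℝ, Measurable X → (∀ x : ℝ, (P {ω | X ω ≤ x}).toReal = G x) →
         (∀ X' : Ω → ℝ, Measurable X' → (∀ x : ℝ, (P {ω | X' ω ≤ x}).toReal = G x) →
            (∫⁻ ω, ENNReal.ofReal (X ω * Y ω) ∂P) ≤
              (∫⁻ ω, ENNReal.ofReal (X' ω * Y ω) ∂P)) →
         X =ᵐ[P] fun ω => Ginv (1 - F (Y ω)))) := by
  obtain ⟨hmono, hcont, htop⟩ := continuous_of_atomless hY hYatomless hF
  have hU : Measurable fun ω => F (Y ω) := hcont.measurable.comp hY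
  have hU01 := ae_distribution_mem_Ioo hY hYpos hYatomless hF hmono hcont htop
  constructor
  · obtain ⟨Z, hZ, hZeq, hlevel, hZG⟩ := exists_measurable_quantile hGmono hGrc hGneg hGtop hGinv
      hU hU01 fun g hg => measure_distribution_le hYpos hF hmono hcont htop hg
    have hint : ∫⁻ ω, ENNReal.ofReal (Ginv (F (Y ω)) * Y ω) ∂P =
        ∫⁻ ω, ENNReal.ofReal (Z ω * Y ω) ∂P := by
      refine lintegral_congr_ae ?_
      filter_upwards [hZeq] with ω hω
      rw [hω]
    have hZ0 := ae_nonneg_of_distribution hGneg hZG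
    have hmax (X : Ω → ℝ) (hX : Measurable X)
        (hXG : ∀ x : ℝ, (P {ω | X ω ≤ x}).toReal = G x) (t : ℝ) (_ : t > 0) :=
      levelDominated_comonotone hY hYpos hF hmono hcont htop hX hZ hXG hZG (hlevel t)
    rw [hint]
    refine ⟨fun x => ?_, fun X hX hXG => ?_, fun hfin X hX hXG hopt => ?_⟩
    · rw [← hZG x]
      congr 1
      refine measure_congr ?_
      filter_upwards [hZeq] with ω hω
      exact congrArg (· ≤ x) hω.symm
    · exact lintegral_ofReal_mul_le_of_levelDominated hY hYpos hX hZ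
        (ae_nonneg_of_distribution hGneg hXG) hZ0 (hmax X hX hXG)
    · have hX0 := ae_nonneg_of_distribution hGneg hXG
      have hle := lintegral_ofReal_mul_le_of_levelDominated hY hYpos hX hZ hX0 hZ0 (hmax X hX hXG)
      exact (ae_eq_of_levelDominated hY hYpos hX hZ hX0 hZ0 (hmax X hX hXG) (hopt Z hZ hZG)
        (hle.trans_lt hfin).ne).trans hZeq
  · have hV01 : ∀ᵐ ω ∂P, 1 - F (Y ω) ∈ Ioo 0 1 := by
      filter_upwards [hU01] with ω hω
      exact ⟨by linarith [hω.2], by linarith [hω.1]⟩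
    obtain ⟨Z, hZ, hZeq, hlevel, hZG⟩ := exists_measurable_quantile hGmono hGrc hGneg hGtop hGinv
      (hU.const_sub 1) hV01 fun g hg => by
        have hlt := measure_distribution_lt hYpos hYatomless hF hmono hcont htop
          (g := 1 - g) ⟨by linarith [hg.2], by linarith [hg.1]⟩
        have hset : {ω | 1 - F (Y ω) ≤ g} = {ω | F (Y ω) < 1 - g}ᶜ := by
          ext ω
          simp only [mem_ofPred_eq, mem_compl_iff, not_lt]
          constructor <;> intro h <;> linarith
        have hcompl := probReal_compl_eq_one_sub (μ := P)
          (measurableSet_lt hU (measurable_const (a := 1 - g)))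
        rw [measureReal_def, measureReal_def, hlt] at hcompl
        rw [hset, hcompl]
        ring
    have hint : ∫⁻ ω, ENNReal.ofReal (Ginv (1 - F (Y ω)) * Y ω) ∂P =
        ∫⁻ ω, ENNReal.ofReal (Z ω * Y ω) ∂P := by
      refine lintegral_congr_ae ?_
      filter_upwards [hZeq] with ω hω
      rw [hω]
    have hZ0 := ae_nonneg_of_distribution hGneg hZG
    have hmin (X : Ω → ℝ) (hX : Measurable X)
        (hXG : ∀ x : ℝ, (P {ω | X ω ≤ x}).toReal = G x) (t : ℝ) (_ : t > 0) :=
      levelDominated_antimonotone hY hYpos hYatomless hF hmono hcont htop hX hZ hXG hZG (hlevel t)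
    rw [hint]
    refine ⟨fun x => ?_, fun X hX hXG => ?_, fun hfin X hX hXG hopt => ?_⟩
    · rw [← hZG x]
      congr 1
      refine measure_congr ?_
      filter_upwards [hZeq] with ω hω
      exact congrArg (· ≤ x) hω.symm
    · exact lintegral_ofReal_mul_le_of_levelDominated hY hYpos hZ hX hZ0
        (ae_nonneg_of_distribution hGneg hXG) (hmin X hX hXG)
    · have hX0 := ae_nonneg_of_distribution hGneg hXG
      exact (ae_eq_of_levelDominated hY hYpos hZ hX hZ0 hX0 (hmin X hX hXG) (hopt Z hZ hZG)
        hfin.ne).symm.trans hZeq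

end
end
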